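/- Assume the standing hypotheses (H1)–(H6). Then there is a constant D > 0 such that for every real 0 < δ < 1 and each sign σ ∈ {+1, −1}, the two-dimensional Lebesgue measure of the set of p ∈ ℝ² for which there exists an integer j < 0 with ℓ({k ∈ F : |e(p + σ k)| ≤ M^j}) ≥ (M^j/δ)^{1/n₀} is at most D δ². -/

import Mathlib

open MeasureTheory Polynomial

/-- The nonflatness condition (H5). -/
def NonFlatCond (e : ℝ × ℝ → ℝ) (r n₀ : ℕ) : Prop :=
  ∀ kt : ℝ × ℝ, e kt = 0 →
    (∀ U ∈ nhds (0 : ℝ), ∀ f : ℝ → ℝ, ContDiffOn ℝ (r - 2 : ℕ) f U → f 0 = 0 →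
      (∀ t ∈ U, e (kt.1 + t, kt.2 + f t) = 0) →
      ∃ m : ℕ, 2 ≤ m ∧ m ≤ n₀ - 1 ∧ iteratedDerivWithin m f U 0 ≠ 0) ∧
    (∀ U ∈ nhds (0 : ℝ), ∀ f : ℝ → ℝ, ContDiffOn ℝ (r - 2 : ℕ) f U → f 0 = 0 →
      (∀ t ∈ U, e (kt.1 + f t, kt.2 + t) = 0) →
      ∃ m : ℕ, 2 ≤ m ∧ m ≤ n₀ - 1 ∧ iteratedDerivWithin m f U 0 ≠ 0)

/-- Auxiliary to the no-nesting condition (H6): for curves `f` through `kt` lying in the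
zero set of `e₁` and curves `g` through `pt` lying in the zero set of `e₂`, some derivative
of `f - g` at `0` of order at most `n₀ - 1` is nonzero (in both coordinate orientations). -/
def NestPairCond (e₁ e₂ : ℝ × ℝ → ℝ) (r n₀ : ℕ) (kt pt : ℝ × ℝ) : Prop :=
  (∀ U ∈ nhds (0 : ℝ), ∀ f g : ℝ → ℝ,
    ContDiffOn ℝ (r - 2 : ℕ) f U → ContDiffOn ℝ (r - 2 : ℕ) g U → f 0 = 0 → g 0 = 0 →
    (∀ t ∈ U, e₁ (kt.1 + t, kt.2 + f t) = 0) →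
    (∀ t ∈ U, e₂ (pt.1 + t, pt.2 + g t) = 0) →
    ∃ m : ℕ, m ≤ n₀ - 1 ∧ iteratedDerivWithin m (fun t => f t - g t) U 0 ≠ 0) ∧
  (∀ U ∈ nhds (0 : ℝ), ∀ f g : ℝ → ℝ,
    ContDiffOn ℝ (r - 2 : ℕ) f U → ContDiffOn ℝ (r - 2 : ℕ) g U → f 0 = 0 → g 0 = 0 →
    (∀ t ∈ U, e₁ (kt.1 + f t, kt.2 + t) = 0) →
    (∀ t ∈ U, e₂ (pt.1 + g t, pt.2 + t) = 0) →
    ∃ m : ℕ, m ≤ n₀ - 1 ∧ iteratedDerivWithin m (fun t => f t - g t) U 0 ≠ 0)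

/-- The no-nesting condition (H6), including the reflected condition (curves in `-F`)
when `e` is not an even function. -/
def NoNestingCond (e : ℝ × ℝ → ℝ) (r n₀ : ℕ) : Prop :=
  (∀ kt pt : ℝ × ℝ, e kt = 0 → e pt = 0 → kt ≠ pt → NestPairCond e e r n₀ kt pt) ∧
  ((¬ ∀ k : ℝ × ℝ, e (-k) = e k) →
    ∀ kt pt : ℝ × ℝ, e kt = 0 → e (-pt) = 0 →
      NestPairCond e (fun k => e (-k)) r n₀ kt pt)

/-- The second derivative (Hessian) of `e : ℝ² → ℝ` at `p` in directions `u`, `v`. -/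
noncomputable def hess2 (e : ℝ × ℝ → ℝ) (p u v : ℝ × ℝ) : ℝ :=
  fderiv ℝ (fun q => fderiv ℝ e q u) p v

/-- (H4): the Hessian matrix of `e` at `p` is nonsingular, with one positive and one
negative eigenvalue. -/
def HessCond (e : ℝ × ℝ → ℝ) (p : ℝ × ℝ) : Prop :=
  ∃ μ₁ μ₂ : ℝ, 0 < μ₁ ∧ μ₂ < 0 ∧
    (!![hess2 e p (1, 0) (1, 0), hess2 e p (1, 0) (0, 1);
        hess2 e p (0, 1) (1, 0), hess2 e p (0, 1) (0, 1)]).charpoly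
      = (X - Polynomial.C μ₁) * (X - Polynomial.C μ₂)

section
open Set Filter Topology

namespace FS

theorem contDiff_param (n : ℕ) : ∀ (E : Type) [NormedAddCommGroup E] [NormedSpace ℝ E]
    [CompleteSpace E] (f : (ℝ × ℝ) × ℝ → E), ContDiff ℝ n f →
    ContDiff ℝ n (fun x : ℝ × ℝ => ∫ t in (0:ℝ)..1, f (x, t)) := by
  induction n with
  | zero =>
    intro E _ _ _ f hf
    have hf' : Continuous f := hf.continuous
    refine contDiff_zero.2 ?_
    exact intervalIntegral.continuous_parametric_intervalIntegral_of_continuous' (f := fun x t => f (x,t)) (by simpa [Function.uncurry_def] using hf') 0 1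
  | succ n ih =>
    intro E _ _ _ f hf
    have hf1 : ContDiff ℝ 1 f := hf.of_le (by norm_cast; omega)
    have hfd : ContDiff ℝ n (fderiv ℝ f) := by
      apply hf.fderiv_right; norm_cast
    let F' : ℝ × ℝ → ℝ → (ℝ × ℝ →L[ℝ] E) := fun x t =>
      (fderiv ℝ f (x, t)).comp (ContinuousLinearMap.inl ℝ (ℝ × ℝ) ℝ)
    have hF' : ContDiff ℝ n (fun z : (ℝ × ℝ) × ℝ => F' z.1 z.2) := by
      exact hfd.clm_comp contDiff_const
    have hF'c : Continuous (fun z : (ℝ × ℝ) × ℝ => F' z.1 z.2) := hF'.continuous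
    have key : ∀ x₀ : ℝ × ℝ, HasFDerivAt (fun x : ℝ × ℝ => ∫ t in (0:ℝ)..1, f (x, t))
        (∫ t in (0:ℝ)..1, F' x₀ t) x₀ := by
      intro x₀
      have hK : IsCompact ((Metric.closedBall x₀ 1) ×ˢ (Icc (0:ℝ) 1)) :=
        (isCompact_closedBall _ _).prod isCompact_Icc
      obtain ⟨C, hC⟩ := hK.exists_bound_of_continuousOn hF'c.continuousOn
      refine intervalIntegral.hasFDerivAt_integral_of_dominated_of_fderiv_le
        (F := fun x t => f (x, t)) (F' := F') (bound := fun _ => C)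
        (s := Metric.closedBall x₀ 1)
        (Metric.closedBall_mem_nhds _ one_pos) ?_ ?_ ?_ ?_ ?_ ?_
      · refine Eventually.of_forall fun x => ?_
        exact (hf.continuous.comp (by fun_prop : Continuous fun t : ℝ => (x, t))).aestronglyMeasurable
      · exact (hf.continuous.comp (by fun_prop : Continuous fun t : ℝ => (x₀, t))).intervalIntegrable _ _
      · exact (hF'c.comp (by fun_prop : Continuous fun t : ℝ => (x₀, t))).aestronglyMeasurable
      · refine Eventually.of_forall fun t ht x hx => ?_
        rw [uIoc_of_le zero_le_one] at ht
        exact hC (x, t) ⟨hx, Ioc_subset_Icc_self ht⟩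
      · simp
      · refine Eventually.of_forall fun t ht x hx => ?_
        have h1 : HasFDerivAt f (fderiv ℝ f (x, t)) (x, t) :=
          (hf1.differentiable one_ne_zero _).hasFDerivAt
        have h2 : HasFDerivAt (fun x : ℝ × ℝ => (x, t)) (ContinuousLinearMap.inl ℝ (ℝ × ℝ) ℝ) x :=
          hasFDerivAt_prodMk_left x t
        exact h1.comp x h2
    have hfd' : fderiv ℝ (fun x : ℝ × ℝ => ∫ t in (0:ℝ)..1, f (x, t))
        = fun x => ∫ t in (0:ℝ)..1, F' x t := funext fun x => (key x).fderiv
    push_cast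
    rw [contDiff_succ_iff_fderiv]
    refine ⟨fun x => (key x).differentiableAt, ?_, ?_⟩
    · intro h; exact absurd h (by simp)
    · rw [hfd']
      exact ih _ (fun z => F' z.1 z.2) hF'

/-- Hadamard's lemma. -/
theorem hadamard {n : ℕ} {u : ℝ × ℝ → ℝ} (hu : ContDiff ℝ (n + 1 : ℕ) u) (h0 : ∀ s, u (0, s) = 0) :
    ∃ v : ℝ × ℝ → ℝ, ContDiff ℝ n v ∧ ∀ x s, u (x, s) = x * v (x, s) := by
  let g : (ℝ × ℝ) × ℝ → ℝ := fun z => fderiv ℝ u (z.2 * z.1.1, z.1.2) (1, 0)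
  have hfd : ContDiff ℝ n (fderiv ℝ u) := by
    apply hu.fderiv_right; norm_cast
  have hg : ContDiff ℝ n g := by
    have : ContDiff ℝ n (fun z : (ℝ × ℝ) × ℝ => fderiv ℝ u (z.2 * z.1.1, z.1.2)) :=
      hfd.comp (by fun_prop)
    exact this.clm_apply contDiff_const
  refine ⟨_, contDiff_param n ℝ g hg, fun x s => ?_⟩
  have hd : ∀ t : ℝ, HasDerivAt (fun t => u (t * x, s)) (x * g ((x, s), t)) t := by
    intro t
    have h1 : HasFDerivAt u (fderiv ℝ u (t * x, s)) (t * x, s) :=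
      ((hu.of_le (by norm_cast; omega : ((1 : ℕ) : WithTop ℕ∞) ≤ _)).differentiable (by norm_num) _).hasFDerivAt
    have h2 : HasDerivAt (fun t : ℝ => (t * x, s)) (x, 0) t := by
      have := ((hasDerivAt_id t).mul_const x).prodMk (hasDerivAt_const t s)
      simpa using this
    have h3 := h1.comp_hasDerivAt t h2
    have h4 : fderiv ℝ u (t * x, s) (x, 0) = x * g ((x, s), t) := by
      have : ((x, 0) : ℝ × ℝ) = x • (1, 0) := by simp
      rw [this, map_smul]; rfl
    rw [h4] at h3
    exact h3
  have hc : Continuous (fun t => x * g ((x, s), t)) :=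
    continuous_const.mul (hg.continuous.comp (by fun_prop))
  have := intervalIntegral.integral_eq_sub_of_hasDerivAt (a := 0) (b := 1) (fun t _ => hd t) (hc.intervalIntegrable _ _)
  rw [intervalIntegral.integral_const_mul] at this
  simp only [zero_mul, one_mul, h0, sub_zero] at this
  exact this.symm

theorem extend {n : ℕ} {f : ℝ → ℝ} {x₀ : ℝ} (hf : ContDiffAt ℝ n f x₀) :
    ∃ g : ℝ → ℝ, ContDiff ℝ n g ∧ f =ᶠ[𝓝 x₀] g := by
  have h := hf.eventually (by simp)
  obtain ⟨δ, hδ, hb⟩ := Metric.eventually_nhds_iff_ball.1 h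
  let φ : ContDiffBump x₀ := ⟨δ / 4, δ / 2, by positivity, by linarith⟩
  refine ⟨fun x => φ x * f x, ?_, ?_⟩
  · rw [contDiff_iff_contDiffAt]
    intro x
    by_cases hx : x ∈ Metric.ball x₀ δ
    · exact φ.contDiffAt.mul (hb x hx)
    · have hx' : x ∉ tsupport φ := by
        rw [φ.tsupport_eq]
        intro h
        apply hx
        have : dist x x₀ ≤ δ / 2 := h
        exact Metric.mem_ball.2 (by linarith)
      have : (fun x => φ x * f x) =ᶠ[𝓝 x] fun _ => 0 := by
        have := notMem_tsupport_iff_eventuallyEq.1 hx'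
        filter_upwards [this] with y hy
        simp [hy]
      exact contDiffAt_const.congr_of_eventuallyEq this
  · filter_upwards [φ.eventuallyEq_one] with x hx
    simp [hx]

theorem implicit {n : ℕ} (hn : n ≠ 0) {h : ℝ × ℝ → ℝ} (hh : ContDiff ℝ n h) {x₀ y₀ : ℝ}
    (h0 : h (x₀, y₀) = 0) (hy : fderiv ℝ h (x₀, y₀) (0, 1) ≠ 0) :
    ∃ g : ℝ → ℝ, ContDiff ℝ n g ∧ g x₀ = y₀ ∧ (∀ᶠ x in 𝓝 x₀, h (x, g x) = 0) ∧
      ∀ᶠ z in 𝓝 (x₀, y₀), h z = 0 → z.2 = g z.1 := by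
  have pn : (n : WithTop ℕ∞) ≠ 0 := by exact_mod_cast hn
  have if₂ : (fderiv ℝ h (x₀, y₀) ∘L .inr ℝ ℝ ℝ).IsInvertible := by
    refine ⟨ContinuousLinearEquiv.unitsEquivAut ℝ (Units.mk0 _ hy), ?_⟩
    ext
    simp
  have cdf : ContDiffAt ℝ n h (x₀, y₀) := hh.contDiffAt
  obtain ⟨g, hg, hge⟩ := extend (cdf.contDiffAt_implicitFunction pn if₂)
  refine ⟨g, hg, ?_, ?_, ?_⟩
  · rw [← hge.eq_of_nhds]; exact cdf.implicitFunction_apply_self pn if₂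
  · filter_upwards [cdf.eventually_apply_implicitFunction pn if₂, hge] with x h1 h2
    rw [← h2, h1, h0]
  · have : ∀ᶠ z in 𝓝 (x₀, y₀), cdf.implicitFunction pn if₂ z.1 = g z.1 :=
      (continuous_fst.tendsto (x₀, y₀)).eventually hge
    filter_upwards [cdf.eventually_apply_eq_iff_implicitFunction pn if₂, this] with z h1 h2 hz
    rw [← h2, h1.1 (hz.trans h0.symm)]

theorem volume_le_of_diam {S : Set ℝ} {d : ℝ} (h : ∀ x ∈ S, ∀ y ∈ S, |x - y| ≤ d) :
    volume S ≤ ENNReal.ofReal d := by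
  refine (Real.volume_le_diam S).trans ?_
  refine Metric.ediam_le fun x hx y hy => ?_
  rw [edist_dist]
  exact ENNReal.ofReal_le_ofReal (by simpa [Real.dist_eq] using h x hx y hy)

theorem slope_ge {φ φ' : ℝ → ℝ} {J : Set ℝ} (hJ : J.OrdConnected) {c : ℝ}
    (hd : ∀ t ∈ J, HasDerivAt φ (φ' t) t) (hc : ∀ t ∈ J, c ≤ φ' t) :
    ∀ x ∈ J, ∀ y ∈ J, x ≤ y → c * (y - x) ≤ φ y - φ x := by
  intro x hx y hy hxy
  rcases hxy.eq_or_lt with rfl | hlt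
  · simp
  have hsub : Icc x y ⊆ J := hJ.out hx hy
  obtain ⟨z, hz, hz'⟩ := exists_hasDerivAt_eq_slope φ φ' hlt
    (fun t ht => (hd t (hsub ht)).continuousAt.continuousWithinAt)
    (fun t ht => hd t (hsub (Ioo_subset_Icc_self ht)))
  have := hc z (hsub (Ioo_subset_Icc_self hz))
  rw [hz', le_div_iff₀ (by linarith)] at this
  exact this

theorem slope_abs {φ : ℝ → ℝ} {J : Set ℝ} {c : ℝ}
    (h : ∀ x ∈ J, ∀ y ∈ J, x ≤ y → c * (y - x) ≤ φ y - φ x) (hc : 0 < c) {s : ℝ} :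
    volume {t | t ∈ J ∧ |φ t| ≤ s} ≤ ENNReal.ofReal (2 * (s / c)) := by
  apply volume_le_of_diam
  have key : ∀ x ∈ J, ∀ y ∈ J, x ≤ y → |φ x| ≤ s → |φ y| ≤ s → |x - y| ≤ 2 * (s / c) := by
    intro x hx y hy hxy h1 h2
    have := h x hx y hy hxy
    rw [abs_le] at h1 h2
    rw [abs_sub_comm, abs_of_nonneg (by linarith), ← mul_div_assoc, le_div_iff₀ hc]
    nlinarith
  rintro x ⟨hx, hx'⟩ y ⟨hy, hy'⟩
  rcases le_total x y with hxy | hxy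
  · exact key x hx y hy hxy hx' hy'
  · rw [abs_sub_comm]; exact key y hy x hx hxy hy' hx'

theorem sublevel_pos (k : ℕ) : ∃ A : ℝ, 0 < A ∧ ∀ (D : ℕ → ℝ → ℝ) (J : Set ℝ), J.OrdConnected →
    (∀ i ≤ k, ∀ t ∈ J, HasDerivAt (D i) (D (i + 1) t) t) → ∀ c > 0, (∀ t ∈ J, c ≤ D (k + 1) t) →
    ∀ s > 0, volume {t | t ∈ J ∧ |D 0 t| ≤ s} ≤
      ENNReal.ofReal (A * (s / c) ^ (1 / ((k : ℝ) + 1))) := by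
  induction k with
  | zero =>
    refine ⟨2, by norm_num, fun D J hJ hD c hc hcD s hs => ?_⟩
    have := slope_abs (slope_ge hJ (hD 0 le_rfl) hcD) hc (s := s)
    simpa using this
  | succ k ih =>
    obtain ⟨A, hA, ih⟩ := ih
    refine ⟨2 + A + A, by positivity, fun D J hJ hD c hc hcD s hs => ?_⟩
    have hsl := slope_ge hJ (hD (k + 1) le_rfl) hcD
    set τ := s / c with hτ
    have hτ0 : 0 < τ := div_pos hs hc
    set θ : ℝ := τ ^ (1 / (((k + 1 : ℕ) : ℝ) + 1)) with hθ
    have hθ0 : 0 < θ := Real.rpow_pos_of_pos hτ0 _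
    set β := c * θ with hβ
    have hβ0 : 0 < β := mul_pos hc hθ0
    have e1 : (s / β) ^ (1 / ((k : ℝ) + 1)) = θ := by
      have h1 : s / β = τ ^ (1 - 1 / (((k + 1 : ℕ) : ℝ) + 1)) := by
        rw [Real.rpow_sub hτ0, Real.rpow_one, ← hθ, hβ, hτ]; field_simp
      rw [h1, ← Real.rpow_mul hτ0.le, hθ]
      congr 1
      push_cast
      have : (k : ℝ) + 1 ≠ 0 := by positivity
      have : (k : ℝ) + 1 + 1 ≠ 0 := by positivity
      field_simp
      ring
    have hmid := slope_abs hsl hc (s := β)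
    have hup := ih D {t | t ∈ J ∧ β ≤ D (k + 1) t} ⟨by
        rintro x ⟨hx, hx'⟩ y ⟨hy, hy'⟩ z hz
        have hzJ := hJ.out hx hy hz
        refine ⟨hzJ, ?_⟩
        have := hsl x hx z hzJ hz.1
        nlinarith [hz.1]⟩ (fun i hi t ht => hD i (by omega) t ht.1) β hβ0 (fun t ht => ht.2) s hs
    have hdn := ih (fun i t => - D i t) {t | t ∈ J ∧ D (k + 1) t ≤ -β} ⟨by
        rintro x ⟨hx, hx'⟩ y ⟨hy, hy'⟩ z hz
        have hzJ := hJ.out hx hy hz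
        refine ⟨hzJ, ?_⟩
        have := hsl z hzJ y hy hz.2
        nlinarith [hz.2]⟩ (fun i hi t ht => (hD i (by omega) t ht.1).fun_neg) β hβ0
        (fun t ht => by linarith [ht.2]) s hs
    rw [e1] at hup hdn
    have e2 : 2 * (β / c) = 2 * θ := by rw [hβ]; field_simp
    rw [e2] at hmid
    have hsub : {t | t ∈ J ∧ |D 0 t| ≤ s} ⊆ {t | t ∈ J ∧ |D (k + 1) t| ≤ β} ∪
        ({t | t ∈ {t | t ∈ J ∧ β ≤ D (k + 1) t} ∧ |D 0 t| ≤ s} ∪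
        {t | t ∈ {t | t ∈ J ∧ D (k + 1) t ≤ -β} ∧ |-D 0 t| ≤ s}) := by
      rintro t ⟨ht, hts⟩
      by_cases h : |D (k + 1) t| ≤ β
      · exact Or.inl ⟨ht, h⟩
      · rcases lt_abs.1 (not_le.1 h) with h | h
        · exact Or.inr (Or.inl ⟨⟨ht, h.le⟩, hts⟩)
        · exact Or.inr (Or.inr ⟨⟨ht, by linarith⟩, by rwa [abs_neg]⟩)
    refine (measure_mono hsub).trans ((measure_union_le _ _).trans ?_)
    refine (add_le_add hmid ((measure_union_le _ _).trans (add_le_add hup hdn))).trans ?_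
    rw [← ENNReal.ofReal_add (by positivity) (by positivity),
      ← ENNReal.ofReal_add (by positivity) (by positivity)]
    apply ENNReal.ofReal_le_ofReal
    nlinarith

theorem sign_const {φ : ℝ → ℝ} {J : Set ℝ} (hJ : J.OrdConnected) (hφ : ContinuousOn φ J) {c : ℝ}
    (hc : 0 < c) (h : ∀ t ∈ J, c ≤ |φ t|) : (∀ t ∈ J, c ≤ φ t) ∨ (∀ t ∈ J, c ≤ -φ t) := by
  by_contra hcon
  push Not at hcon
  obtain ⟨⟨x, hx, hx'⟩, ⟨y, hy, hy'⟩⟩ := hcon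
  have h1 : φ x ≤ -c := by
    rcases le_abs.1 (h x hx) with h | h <;> linarith
  have h2 : c ≤ φ y := by
    rcases le_abs.1 (h y hy) with h | h <;> linarith
  have := hJ.isPreconnected.intermediate_value hx hy hφ
  obtain ⟨z, hz, hz0⟩ := this (show (0 : ℝ) ∈ Icc (φ x) (φ y) from ⟨by linarith, by linarith⟩)
  have := h z hz
  rw [hz0, abs_zero] at this
  linarith

theorem sublevel (k : ℕ) : ∃ A : ℝ, 0 < A ∧ ∀ (D : ℕ → ℝ → ℝ) (J : Set ℝ), J.OrdConnected →
    (∀ i ≤ k, ∀ t ∈ J, HasDerivAt (D i) (D (i + 1) t) t) → ContinuousOn (D (k + 1)) J →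
    ∀ c > 0, (∀ t ∈ J, c ≤ |D (k + 1) t|) →
    ∀ s > 0, volume {t | t ∈ J ∧ |D 0 t| ≤ s} ≤
      ENNReal.ofReal (A * (s / c) ^ (1 / ((k : ℝ) + 1))) := by
  obtain ⟨A, hA, h⟩ := sublevel_pos k
  refine ⟨A, hA, fun D J hJ hD hcont c hc hcD s hs => ?_⟩
  rcases sign_const hJ hcont hc hcD with h1 | h1
  · exact h D J hJ hD c hc h1 s hs
  · have := h (fun i t => -D i t) J hJ (fun i hi t ht => (hD i hi t ht).fun_neg) c hc h1 s hs
    simpa only [abs_neg] using this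

end FS

end

section
open Set Filter Topology

namespace FS

/-- first partial derivative -/
noncomputable def dx (G : ℝ × ℝ → ℝ) (z : ℝ × ℝ) : ℝ := fderiv ℝ G z (1, 0)
/-- second partial derivative -/
noncomputable def dy (G : ℝ × ℝ → ℝ) (z : ℝ × ℝ) : ℝ := fderiv ℝ G z (0, 1)

theorem contDiff_dx {n : ℕ} {G : ℝ × ℝ → ℝ} (hG : ContDiff ℝ (n + 1 : ℕ) G) :
    ContDiff ℝ n (dx G) := by
  have hfd : ContDiff ℝ n (fderiv ℝ G) := by
    apply hG.fderiv_right; norm_cast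
  exact hfd.clm_apply contDiff_const

theorem contDiff_dy {n : ℕ} {G : ℝ × ℝ → ℝ} (hG : ContDiff ℝ (n + 1 : ℕ) G) :
    ContDiff ℝ n (dy G) := by
  have hfd : ContDiff ℝ n (fderiv ℝ G) := by
    apply hG.fderiv_right; norm_cast
  exact hfd.clm_apply contDiff_const

theorem chain2 {G : ℝ × ℝ → ℝ} (hG : Differentiable ℝ G) {x y : ℝ → ℝ} {x' y' t : ℝ}
    (hx : HasDerivAt x x' t) (hy : HasDerivAt y y' t) :
    HasDerivAt (fun t => G (x t, y t)) (dx G (x t, y t) * x' + dy G (x t, y t) * y') t := by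
  have h3 := (hG (x t, y t)).hasFDerivAt.comp_hasDerivAt t (hx.prodMk hy)
  have h4 : fderiv ℝ G (x t, y t) (x', y') = dx G (x t, y t) * x' + dy G (x t, y t) * y' := by
    have : ((x', y') : ℝ × ℝ) = x' • (1, 0) + y' • (0, 1) := by simp
    rw [this, map_add, map_smul, map_smul]; simp [dx, dy, mul_comm]
  rw [h4] at h3
  exact h3

/-- Uniform sublevel estimate for a family of functions near the origin. -/
def TE (φ : ℝ × ℝ → ℝ → ℝ) (lam : ℝ × ℝ → ℝ) (k : ℕ) : Prop :=
  ∃ η > 0, ∃ C > 0, ∀ᶠ q in 𝓝 (0 : ℝ × ℝ), 0 < lam q → ∀ s > 0,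
    volume {t : ℝ | |t| < η ∧ |φ q t| ≤ s * lam q} ≤ ENNReal.ofReal (C * s ^ (1 / (k : ℝ)))

theorem vol_abs_lt (η : ℝ) : volume {t : ℝ | |t| < η} = ENNReal.ofReal (2 * η) := by
  have : {t : ℝ | |t| < η} = Ioo (-η) η := by ext t; simp [abs_lt]
  rw [this, Real.volume_Ioo]; congr 1; ring

theorem TE.mono_exp {φ : ℝ × ℝ → ℝ → ℝ} {lam : ℝ × ℝ → ℝ} {k n : ℕ} (h : TE φ lam k)
    (hk : 1 ≤ k) (hkn : k ≤ n) : TE φ lam n := by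
  obtain ⟨η, hη, C, hC, h⟩ := h
  refine ⟨η, hη, C + 2 * η, by positivity, h.mono fun q hq hl s hs => ?_⟩
  rcases le_or_gt s 1 with h1 | h1
  · refine (hq hl s hs).trans (ENNReal.ofReal_le_ofReal ?_)
    have hk' : (0 : ℝ) < k := by exact_mod_cast hk
    have : s ^ (1 / (k : ℝ)) ≤ s ^ (1 / (n : ℝ)) := by
      apply Real.rpow_le_rpow_of_exponent_ge hs h1
      apply one_div_le_one_div_of_le hk'
      exact_mod_cast hkn
    have h2 : 0 < s ^ (1 / (n : ℝ)) := Real.rpow_pos_of_pos hs _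
    nlinarith
  · refine (measure_mono (fun t ht => ht.1)).trans ((vol_abs_lt η).le.trans (ENNReal.ofReal_le_ofReal ?_))
    have : 1 ≤ s ^ (1 / (n : ℝ)) := Real.one_le_rpow h1.le (by positivity)
    nlinarith

theorem TE.mono_lam {φ : ℝ × ℝ → ℝ → ℝ} {lam : ℝ × ℝ → ℝ} {k : ℕ} (h : TE φ (fun _ => 1) k)
    (hl : ∀ᶠ q in 𝓝 (0 : ℝ × ℝ), lam q ≤ 1) : TE φ lam k := by
  obtain ⟨η, hη, C, hC, h⟩ := h
  refine ⟨η, hη, C, hC, ?_⟩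
  filter_upwards [h, hl] with q hq hl h0 s hs
  refine (measure_mono ?_).trans (hq one_pos s hs)
  rintro t ⟨h1, h2⟩
  exact ⟨h1, h2.trans (by nlinarith)⟩

theorem TE.mul {φ ψ χ : ℝ × ℝ → ℝ → ℝ} {lam : ℝ × ℝ → ℝ} {k : ℕ} (h : TE φ lam k) (hk : 1 ≤ k)
    (h' : TE ψ (fun _ => 1) 1)
    (hχ : ∃ η > 0, ∀ᶠ q in 𝓝 (0 : ℝ × ℝ), ∀ t, |t| < η → χ q t = φ q t * ψ q t) :
    TE χ lam (k + 1) := by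
  obtain ⟨η, hη, C, hC, h⟩ := h
  obtain ⟨η₁, hη₁, C₁, hC₁, h'⟩ := h'
  obtain ⟨η₂, hη₂, hχ⟩ := hχ
  refine ⟨min η (min η₁ η₂), by positivity, C + C₁, by positivity, ?_⟩
  filter_upwards [h, h', hχ] with q h h' hχ hl s hs
  have hk' : (0 : ℝ) < k := by exact_mod_cast hk
  set θ := s ^ (1 / ((k + 1 : ℕ) : ℝ)) with hθ
  have hθ0 : 0 < θ := Real.rpow_pos_of_pos hs _
  set a := s / θ with ha
  have ha0 : 0 < a := div_pos hs hθ0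
  have e1 : a ^ (1 / (k : ℝ)) = θ := by
    have h1 : a = s ^ (1 - 1 / ((k + 1 : ℕ) : ℝ)) := by
      rw [Real.rpow_sub hs, Real.rpow_one]
    rw [h1, ← Real.rpow_mul hs.le, hθ]
    congr 1
    push_cast
    field_simp
    ring
  have b1 := h hl a ha0
  have b2 := h' one_pos θ hθ0
  rw [e1] at b1
  simp only [Nat.cast_one, div_one, Real.rpow_one, mul_one] at b2
  refine (measure_mono (t := {t : ℝ | |t| < η ∧ |φ q t| ≤ a * lam q} ∪ {t : ℝ | |t| < η₁ ∧ |ψ q t| ≤ θ}) ?_).trans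
    ((measure_union_le _ _).trans ((add_le_add b1 b2).trans ?_))
  · rintro t ⟨h1, h2⟩
    simp only [lt_min_iff] at h1
    rw [hχ t h1.2.2, abs_mul] at h2
    by_cases h3 : |ψ q t| ≤ θ
    · exact Or.inr ⟨h1.2.1, h3⟩
    · refine Or.inl ⟨h1.1, ?_⟩
      push Not at h3
      have : s = a * θ := by rw [ha]; field_simp
      by_contra h4
      push Not at h4
      have h5 : a * lam q * θ < |φ q t| * |ψ q t| :=
        mul_lt_mul h4 h3.le hθ0 (abs_nonneg _)
      rw [this] at h2
      nlinarith
  · rw [← ENNReal.ofReal_add (by positivity) (by positivity)]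
    apply ENNReal.ofReal_le_ofReal
    nlinarith

theorem ev_split {P : ℝ → ℝ × ℝ → Prop}
    (h : ∀ᶠ z : ℝ × (ℝ × ℝ) in 𝓝 (0, 0), P z.1 z.2) :
    ∃ η > 0, ∀ᶠ q in 𝓝 (0 : ℝ × ℝ), ∀ t : ℝ, |t| < η → P t q := by
  rw [nhds_prod_eq, eventually_prod_iff] at h
  obtain ⟨pa, ha, pb, hb, h⟩ := h
  obtain ⟨η, hη, hb'⟩ := Metric.eventually_nhds_iff_ball.1 ha
  exact ⟨η, hη, hb.mono fun q hq t ht => h (hb' t (by simpa using ht)) hq⟩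

theorem ev_nonzero {Φ : ℝ × (ℝ × ℝ) → ℝ} (hΦ : Continuous Φ) (h0 : Φ (0, 0) ≠ 0) :
    ∃ c > 0, ∃ η > 0, ∀ᶠ q in 𝓝 (0 : ℝ × ℝ), ∀ t : ℝ, |t| < η → c ≤ |Φ (t, q)| := by
  refine ⟨|Φ (0, 0)| / 2, by positivity, ev_split (P := fun t q => _ ≤ |Φ (t, q)|) ?_⟩
  have : ∀ᶠ z in 𝓝 ((0, 0) : ℝ × (ℝ × ℝ)), |Φ (0, 0)| / 2 < |Φ z| :=
    (hΦ.abs.tendsto _).eventually (lt_mem_nhds (half_lt_self (abs_pos.2 h0)))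
  exact this.mono fun z hz => hz.le

theorem TE_bdd {φ : ℝ × ℝ → ℝ → ℝ}
    (h : ∃ c > 0, ∃ η > 0, ∀ᶠ q in 𝓝 (0 : ℝ × ℝ), ∀ t : ℝ, |t| < η → c ≤ |φ q t|) :
    TE φ (fun _ => 1) 1 := by
  obtain ⟨c, hc, η, hη, h⟩ := h
  refine ⟨η, hη, 2 * η / c, by positivity, h.mono fun q hq _ s hs => ?_⟩
  simp only [Nat.cast_one, div_one, Real.rpow_one, mul_one]
  by_cases hsc : s < c
  · have : {t : ℝ | |t| < η ∧ |φ q t| ≤ s} = ∅ := by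
      ext t
      simp only [mem_ofPred_eq, mem_empty_iff_false, iff_false]
      rintro ⟨h1, h2⟩
      linarith [hq t h1]
    rw [this]; simp
  · refine (measure_mono (fun t ht => ht.1)).trans ((vol_abs_lt η).le.trans (ENNReal.ofReal_le_ofReal ?_))
    rw [div_mul_eq_mul_div, le_div_iff₀ hc]
    push Not at hsc
    nlinarith

theorem ordConn_abs (η : ℝ) : OrdConnected {t : ℝ | |t| < η} := by
  have : {t : ℝ | |t| < η} = Ioo (-η) η := by ext t; simp [abs_lt]
  rw [this]; exact ordConnected_Ioo

theorem TE_slope {φ : ℝ × ℝ → ℝ → ℝ}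
    (h : ∃ c > 0, ∃ η > 0, ∀ᶠ q in 𝓝 (0 : ℝ × ℝ), ∀ x : ℝ, |x| < η → ∀ y : ℝ, |y| < η → x ≤ y →
      c * (y - x) ≤ φ q y - φ q x) :
    TE φ (fun _ => 1) 1 := by
  obtain ⟨c, hc, η, hη, h⟩ := h
  refine ⟨η, hη, 2 / c, by positivity, h.mono fun q hq _ s hs => ?_⟩
  have := slope_abs (J := {t : ℝ | |t| < η}) hq hc (s := s)
  simp only [Nat.cast_one, div_one, Real.rpow_one, mul_one]
  refine this.trans (ENNReal.ofReal_le_ofReal (le_of_eq ?_))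
  ring

theorem TE_neg {φ : ℝ × ℝ → ℝ → ℝ} {lam : ℝ × ℝ → ℝ} {k : ℕ}
    (h : TE (fun q t => -φ q t) lam k) : TE φ lam k := by
  simpa only [TE, abs_neg] using h

theorem TE_deriv {k : ℕ} {D : ℕ → ℝ × ℝ → ℝ → ℝ}
    (hD : ∀ i ≤ k, ∀ q t, HasDerivAt (D i q) (D (i + 1) q t) t)
    (hc : Continuous (fun z : ℝ × (ℝ × ℝ) => D (k + 1) z.2 z.1)) (h0 : D (k + 1) 0 0 ≠ 0) :
    TE (D 0) (fun _ => 1) (k + 1) := by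
  obtain ⟨A, hA, hsub⟩ := sublevel k
  obtain ⟨c, hc0, η, hη, h⟩ := ev_nonzero hc h0
  refine ⟨η, hη, A * (1 / c) ^ (1 / ((k : ℝ) + 1)), by positivity, h.mono fun q hq _ s hs => ?_⟩
  have := hsub (fun i => D i q) {t : ℝ | |t| < η} (ordConn_abs η) (fun i hi t _ => hD i hi q t)
    (hc.comp (by fun_prop : Continuous fun t : ℝ => (t, q))).continuousOn c hc0 hq s hs
  simp only [mul_one]
  refine this.trans (ENNReal.ofReal_le_ofReal (le_of_eq ?_))
  push_cast
  rw [mul_assoc, ← Real.mul_rpow (by positivity) hs.le]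
  congr 2
  ring

theorem hasDerivAt_iter {N i : ℕ} {f : ℝ → ℝ} (hf : ContDiff ℝ N f) (hi : i < N) (t : ℝ) :
    HasDerivAt (iteratedDeriv i f) (iteratedDeriv (i + 1) f t) t := by
  rw [iteratedDeriv_succ]
  exact (hf.differentiable_iteratedDeriv i (by exact_mod_cast hi) t).hasDerivAt

theorem TE_F1_NN {N k : ℕ} {f g : ℝ → ℝ} (hf : ContDiff ℝ N f) (hg : ContDiff ℝ N g)
    (hk : k + 1 ≤ N) (hne : iteratedDeriv (k + 1) f 0 ≠ iteratedDeriv (k + 1) g 0) :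
    TE (fun q t => f t + q.2 - g (t + q.1)) (fun _ => 1) (k + 1) := by
  let D : ℕ → ℝ × ℝ → ℝ → ℝ := fun i q t =>
    iteratedDeriv i f t + (if i = 0 then q.2 else 0) - iteratedDeriv i g (t + q.1)
  have hD0 : D 0 = fun q t => f t + q.2 - g (t + q.1) := by
    funext q t; simp [D]
  rw [← hD0]
  apply TE_deriv
  · intro i hi q t
    have h1 := hasDerivAt_iter hf (show i < N by omega) t
    have h2 := (hasDerivAt_iter hg (show i < N by omega) (t + q.1)).comp_add_const t q.1
    have := (h1.add_const (if i = 0 then q.2 else 0)).fun_sub h2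
    simpa [D] using this
  · have c1 := hf.continuous_iteratedDeriv (k + 1) (by exact_mod_cast hk)
    have c2 := hg.continuous_iteratedDeriv (k + 1) (by exact_mod_cast hk)
    simp only [D, Nat.add_eq_zero_iff, one_ne_zero, and_false, if_false, add_zero]
    fun_prop
  · simp only [D]
    simpa using sub_ne_zero.2 hne

theorem TE_F1_Nest {N k : ℕ} {f : ℝ → ℝ} (hf : ContDiff ℝ N f) (hk : k + 2 ≤ N)
    (hne : iteratedDeriv (k + 2) f 0 ≠ 0) :
    TE (fun q t => f t + q.2 - f (t + q.1)) (fun q => ‖q‖) (k + 1) := by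
  obtain ⟨A, hA, hsub⟩ := sublevel k
  have cm := hf.continuous_iteratedDeriv (k + 2) (by exact_mod_cast hk)
  obtain ⟨c, hc0, hcev⟩ : ∃ c > 0, ∀ᶠ t in 𝓝 (0 : ℝ), c ≤ |iteratedDeriv (k + 2) f t| := by
    refine ⟨|iteratedDeriv (k + 2) f 0| / 2, by positivity, ?_⟩
    have : ∀ᶠ t in 𝓝 (0 : ℝ), |iteratedDeriv (k + 2) f 0| / 2 < |iteratedDeriv (k + 2) f t| :=
      (cm.abs.tendsto _).eventually (lt_mem_nhds (half_lt_self (abs_pos.2 hne)))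
    exact this.mono fun z hz => hz.le
  obtain ⟨K, T, hT, hK⟩ := (hf.of_le (by norm_cast; omega : ((1 : ℕ) : WithTop ℕ∞) ≤ N)).contDiffAt.exists_lipschitzOnWith (x := (0 : ℝ))
  obtain ⟨η₀, hη₀, hb⟩ := Metric.eventually_nhds_iff_ball.1 (hcev.and hT)
  have hball : ∀ t : ℝ, |t| < η₀ → c ≤ |iteratedDeriv (k + 2) f t| ∧ t ∈ T := fun t ht =>
    hb t (by simpa using ht)
  have hslope : ∀ x, |x| < η₀ → ∀ y, |y| < η₀ →
      c * |y - x| ≤ |iteratedDeriv (k + 1) f y - iteratedDeriv (k + 1) f x| := by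
    have key : ∀ x, |x| < η₀ → ∀ y, |y| < η₀ → x ≤ y →
      c * |y - x| ≤ |iteratedDeriv (k + 1) f y - iteratedDeriv (k + 1) f x| := by
      intro x hx y hy hxy
      rw [abs_of_nonneg (sub_nonneg.2 hxy)]
      rcases sign_const (ordConn_abs η₀) cm.continuousOn hc0 (fun t ht => (hball t ht).1) with h | h
      · exact (slope_ge (ordConn_abs η₀) (fun t _ => hasDerivAt_iter hf (by omega) t) h x hx y hy hxy).trans
          (le_abs_self _)
      · have := slope_ge (ordConn_abs η₀) (fun t _ => (hasDerivAt_iter hf (by omega) t).fun_neg) h x hx y hy hxy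
        refine this.trans ?_
        rw [abs_sub_comm]
        refine le_trans (le_of_eq ?_) (le_abs_self _)
        ring
    intro x hx y hy
    rcases le_total x y with h | h
    · exact key x hx y hy h
    · rw [abs_sub_comm, abs_sub_comm (iteratedDeriv (k + 1) f y)]
      exact key y hy x hx h
  set L : ℝ := 2 * K + 1 with hL
  have hL1 : 1 ≤ L := by have := K.2; simp [hL]
  refine ⟨η₀ / 2, by positivity, A * (L / c) ^ (1 / ((k : ℝ) + 1)) + 2 * (η₀ / 2) * 2 ^ (1 / ((k : ℝ) + 1)), by positivity, ?_⟩
  filter_upwards [Metric.ball_mem_nhds (0 : ℝ × ℝ) (half_pos hη₀)] with q hq hl s hs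
  have hqn : ‖q‖ < η₀ / 2 := by simpa using hq
  have hqmax : ‖q‖ = max |q.1| |q.2| := by simp [Prod.norm_def]
  have hq1 : |q.1| ≤ ‖q‖ := by rw [hqmax]; exact le_max_left _ _
  have hsh : ∀ t, |t| < η₀ / 2 → |t| < η₀ ∧ |t + q.1| < η₀ := by
    intro t ht
    refine ⟨by linarith, (abs_add_le _ _).trans_lt (by linarith)⟩
  push_cast
  by_cases hcase : |q.2| ≤ L * |q.1|
  · have hq1' : ‖q‖ ≤ L * |q.1| := by
      rw [hqmax]
      exact max_le (by nlinarith [abs_nonneg q.1]) hcase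
    have hq10 : 0 < |q.1| := by
      by_contra h
      have : |q.1| = 0 := le_antisymm (not_lt.1 h) (abs_nonneg _)
      rw [this] at hq1'
      linarith
    let D : ℕ → ℝ → ℝ := fun i t =>
      iteratedDeriv i f t + (if i = 0 then q.2 else 0) - iteratedDeriv i f (t + q.1)
    have := hsub D {t : ℝ | |t| < η₀ / 2} (ordConn_abs _) (by
        intro i hi t _
        have h1 := hasDerivAt_iter hf (show i < N by omega) t
        have h2 := (hasDerivAt_iter hf (show i < N by omega) (t + q.1)).comp_add_const t q.1
        have := (h1.add_const (if i = 0 then q.2 else 0)).fun_sub h2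
        simpa [D] using this) (by
        have c1 := hf.continuous_iteratedDeriv (k + 1) (by norm_cast; omega)
        apply Continuous.continuousOn
        simp only [D]
        fun_prop) (c * |q.1|) (by positivity) (by
        intro t ht
        have h := hsh t ht
        have := hslope (t + q.1) h.2 t h.1
        simpa [D] using this) (s * ‖q‖) (by positivity)
    have hset : {t : ℝ | |t| < η₀ / 2 ∧ |f t + q.2 - f (t + q.1)| ≤ s * ‖q‖} =
        {t | t ∈ {t : ℝ | |t| < η₀ / 2} ∧ |D 0 t| ≤ s * ‖q‖} := by simp [D]
    rw [hset]
    refine this.trans (ENNReal.ofReal_le_ofReal ?_)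
    have h1 : s * ‖q‖ / (c * |q.1|) ≤ L / c * s := by
      rw [div_le_iff₀ (by positivity)]
      have : L / c * s * (c * |q.1|) = s * (L * |q.1|) := by field_simp
      rw [this]
      gcongr
    have h2 : (s * ‖q‖ / (c * |q.1|)) ^ (1 / ((k : ℝ) + 1)) ≤
        (L / c) ^ (1 / ((k : ℝ) + 1)) * s ^ (1 / ((k : ℝ) + 1)) := by
      rw [← Real.mul_rpow (by positivity) hs.le]
      exact Real.rpow_le_rpow (by positivity) h1 (by positivity)
    have h3 : 0 ≤ 2 * (η₀ / 2) * 2 ^ (1 / ((k : ℝ) + 1)) * s ^ (1 / ((k : ℝ) + 1)) := by positivity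
    nlinarith
  · push Not at hcase
    have hn : ‖q‖ = |q.2| := by
      rw [hqmax]; apply max_eq_right; nlinarith [abs_nonneg q.1]
    have hlow : ∀ t, |t| < η₀ / 2 → ‖q‖ / 2 ≤ |f t + q.2 - f (t + q.1)| := by
      intro t ht
      have h := hsh t ht
      have hlip := hK.dist_le_mul t (hball t h.1).2 (t + q.1) (hball _ h.2).2
      simp only [Real.dist_eq] at hlip
      have h5 : |t - (t + q.1)| = |q.1| := by rw [← abs_neg]; congr 1; ring
      rw [h5] at hlip
      have h6 : |q.2| ≤ |f t + q.2 - f (t + q.1)| + |f t - f (t + q.1)| := by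
        have := abs_sub (f t + q.2 - f (t + q.1)) (f t - f (t + q.1))
        refine le_trans (le_of_eq ?_) this
        congr 1; ring
      have h7 : (K : ℝ) * |q.1| ≤ |q.2| / 2 := by
        rw [hL] at hcase
        nlinarith [abs_nonneg q.1]
      rw [hn]; linarith
    by_cases hs2 : s < 1 / 2
    · have : {t : ℝ | |t| < η₀ / 2 ∧ |f t + q.2 - f (t + q.1)| ≤ s * ‖q‖} = ∅ := by
        ext t
        simp only [mem_ofPred_eq, mem_empty_iff_false, iff_false]
        rintro ⟨h1, h2⟩
        have := hlow t h1
        nlinarith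
      rw [this]; simp
    · refine (measure_mono (fun t ht => ht.1)).trans ((vol_abs_lt _).le.trans (ENNReal.ofReal_le_ofReal ?_))
      have h1 : 1 ≤ 2 ^ (1 / ((k : ℝ) + 1)) * s ^ (1 / ((k : ℝ) + 1)) := by
        rw [← Real.mul_rpow (by positivity) hs.le]
        push Not at hs2
        exact Real.one_le_rpow (by linarith) (by positivity)
      have h3 : 0 ≤ A * (L / c) ^ (1 / ((k : ℝ) + 1)) * s ^ (1 / ((k : ℝ) + 1)) := by positivity
      nlinarith

end FS

end

section
open Set Filter Topology

namespace FS

theorem dxdy_symm {n : ℕ} {G : ℝ × ℝ → ℝ} (hG : ContDiff ℝ (n + 2 : ℕ) G) (z : ℝ × ℝ) :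
    dy (dx G) z = dx (dy G) z := by
  have hfd : ContDiff ℝ (n + 1 : ℕ) (fderiv ℝ G) := by
    apply hG.fderiv_right; norm_cast
  have hd : DifferentiableAt ℝ (fderiv ℝ G) z := hfd.differentiable (by norm_cast) z
  have hs : IsSymmSndFDerivAt ℝ G z := hG.contDiffAt.isSymmSndFDerivAt (by simp)
  have h1 : ∀ u v : ℝ × ℝ, fderiv ℝ (fun z => fderiv ℝ G z u) z v = fderiv ℝ (fderiv ℝ G) z v u := by
    intro u v
    rw [fderiv_clm_apply hd (differentiableAt_const u)]
    simp
  show fderiv ℝ (fun z => fderiv ℝ G z (1, 0)) z (0, 1) = fderiv ℝ (fun z => fderiv ℝ G z (0, 1)) z (1, 0)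
  rw [h1, h1]
  exact hs (0, 1) (1, 0)

theorem hasDerivAt_mul_cont {w : ℝ → ℝ} (hw : ContinuousAt w 0) :
    HasDerivAt (fun x => x * w x) (w 0) 0 := by
  rw [hasDerivAt_iff_tendsto_slope]
  have : Tendsto w (𝓝[≠] 0) (𝓝 (w 0)) := hw.tendsto.mono_left nhdsWithin_le_nhds
  refine this.congr' ?_
  filter_upwards [self_mem_nhdsWithin] with x hx
  have hx : x ≠ 0 := hx
  simp [slope, hx]

theorem diff_of {n : ℕ} {E F : Type*} [NormedAddCommGroup E] [NormedSpace ℝ E]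
    [NormedAddCommGroup F] [NormedSpace ℝ F] {f : E → F}
    (hf : ContDiff ℝ n f) (hn : 1 ≤ n) : Differentiable ℝ f :=
  hf.differentiable (by norm_cast; omega)

theorem blowup {N : ℕ} {G : ℝ × ℝ → ℝ} (hN : 1 ≤ N) (hG : ContDiff ℝ (N + 2 : ℕ) G) (h0 : G 0 = 0)
    (hx : dx G 0 = 0) (hy : dy G 0 = 0) :
    ∃ h : ℝ × ℝ → ℝ, ContDiff ℝ N h ∧ (∀ x s, G (x, x * s) = x ^ 2 * h (x, s)) ∧
      ∀ s, h (0, s) = (dx (dx G) 0 + 2 * dx (dy G) 0 * s + dy (dy G) 0 * s ^ 2) / 2 := by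
  have hu : ContDiff ℝ (N + 1 + 1 : ℕ) (fun z : ℝ × ℝ => G (z.1, z.1 * z.2)) :=
    hG.comp (by fun_prop : ContDiff ℝ (N + 1 + 1 : ℕ) fun z : ℝ × ℝ => (z.1, z.1 * z.2))
  obtain ⟨v, hv, hvu⟩ := hadamard hu (fun s => by simp only [zero_mul]; exact h0)
  have hGd := diff_of hG (by omega)
  have hdx : ContDiff ℝ (N + 1 : ℕ) (dx G) := contDiff_dx hG
  have hdy : ContDiff ℝ (N + 1 : ℕ) (dy G) := contDiff_dy hG
  have hvs : ∀ s, Differentiable ℝ (fun x => v (x, s)) := fun s =>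
    (diff_of hv (by omega)).comp (by fun_prop)
  have hmul : ∀ s x : ℝ, HasDerivAt (fun x => x * s) s x := fun s x => by
    simpa using (hasDerivAt_id x).mul_const s
  have hu1 : ∀ s x : ℝ, HasDerivAt (fun x => G (x, x * s)) (dx G (x, x * s) * 1 + dy G (x, x * s) * s) x :=
    fun s x => chain2 hGd (hasDerivAt_id x) (hmul s x)
  have hu2 : ∀ s, (fun x => G (x, x * s)) = fun x => x * v (x, s) := fun s => funext fun x => hvu x s
  have hv0 : ∀ s, v (0, s) = 0 := by
    intro s
    have h1 := hu1 s 0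
    rw [hu2 s] at h1
    have h2 := hasDerivAt_mul_cont (hvs s).continuous.continuousAt
    have := h1.unique h2
    simp only [zero_mul, ← Prod.zero_eq_mk, hx, hy] at this
    simpa using this.symm
  obtain ⟨h, hh, hhv⟩ := hadamard hv hv0
  refine ⟨h, hh, fun x s => by rw [hvu x s, hhv x s]; ring, fun s => ?_⟩
  have hv' : HasDerivAt (fun x => v (x, s)) (h (0, s)) 0 := by
    have : (fun x => v (x, s)) = fun x => x * h (x, s) := funext fun x => hhv x s
    rw [this]
    exact hasDerivAt_mul_cont (w := fun x => h (x, s)) (hh.continuous.comp (by fun_prop)).continuousAt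
  have hE : (fun x => dx G (x, x * s) * 1 + dy G (x, x * s) * s) =
      fun x => v (x, s) + x * deriv (fun x => v (x, s)) x := by
    funext x
    have h1 := hu1 s x
    rw [hu2 s] at h1
    have h2 := (hasDerivAt_id x).fun_mul (hvs s x).hasDerivAt
    have := h1.unique h2
    simpa using this
  have hL : HasDerivAt (fun x => dx G (x, x * s) * 1 + dy G (x, x * s) * s)
      ((dx (dx G) (0, 0 * s) * 1 + dy (dx G) (0, 0 * s) * s) * 1 +
        (dx (dy G) (0, 0 * s) * 1 + dy (dy G) (0, 0 * s) * s) * s) 0 :=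
    ((chain2 (diff_of hdx (by omega)) (hasDerivAt_id (0 : ℝ)) (hmul s 0)).mul_const 1).fun_add
      ((chain2 (diff_of hdy (by omega)) (hasDerivAt_id (0 : ℝ)) (hmul s 0)).mul_const s)
  rw [hE] at hL
  have hcd : Continuous (deriv (fun x => v (x, s))) := by
    have : ContDiff ℝ (N + 1 : ℕ) (fun x => v (x, s)) := hv.comp (by fun_prop)
    exact this.continuous_deriv (by norm_cast; omega)
  have hR := hv'.fun_add (hasDerivAt_mul_cont hcd.continuousAt)
  have := hL.unique hR
  rw [hv'.deriv] at this
  simp only [zero_mul, ← Prod.zero_eq_mk, dxdy_symm hG] at this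
  linarith

theorem branch_of_blowup {N : ℕ} {G h : ℝ × ℝ → ℝ} (hN : 1 ≤ N) {A B C : ℝ}
    (hh : ContDiff ℝ N h)
    (hGh : ∀ x s, G (x, x * s) = x ^ 2 * h (x, s))
    (hA : ∀ s, h (0, s) = (A + 2 * B * s + C * s ^ 2) / 2)
    (hdet : A * C - B * B ≠ 0) {s₀ : ℝ} (hs₀ : A + 2 * B * s₀ + C * s₀ ^ 2 = 0) :
    ∃ f : ℝ → ℝ, ContDiff ℝ N f ∧ f 0 = 0 ∧ (∀ᶠ x in 𝓝 0, G (x, f x) = 0) ∧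
      iteratedDeriv 1 f 0 = s₀ ∧
      ∀ᶠ z : ℝ × ℝ in 𝓝 (0, s₀), G (z.1, z.1 * z.2) = 0 → z.1 * z.2 = f z.1 := by
  have hκ : B + C * s₀ ≠ 0 := by
    intro h
    apply hdet
    have h1 : A + B * s₀ = 0 := by linear_combination hs₀ - s₀ * h
    linear_combination C * h1 - B * h
  have hd : dy h (0, s₀) = B + C * s₀ := by
    have h1 := chain2 (diff_of hh hN) (hasDerivAt_const s₀ (0 : ℝ)) (hasDerivAt_id s₀)
    have h2 : HasDerivAt (fun s => h (0, s)) (B + C * s₀) s₀ := by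
      have e : (fun s => h (0, s)) = fun s => (A + 2 * B * s + C * s ^ 2) / 2 := funext hA
      rw [e]
      have a1 : HasDerivAt (fun s : ℝ => A + 2 * B * s) (2 * B) s₀ := by
        simpa using ((hasDerivAt_id s₀).const_mul (2 * B)).const_add A
      have a2 : HasDerivAt (fun s : ℝ => C * s ^ 2) (C * (2 * s₀)) s₀ := by
        simpa using (hasDerivAt_pow 2 s₀).const_mul C
      have := (a1.fun_add a2).div_const 2
      have e2 : (2 * B + C * (2 * s₀)) / 2 = B + C * s₀ := by ring
      rw [e2] at this
      exact this
    have := h1.unique h2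
    simpa using this
  obtain ⟨S, hS, hS0, hS1, hS2⟩ := implicit (by omega) hh (x₀ := 0) (y₀ := s₀)
    (by rw [hA, hs₀]; simp) (by show dy h (0, s₀) ≠ 0; rw [hd]; exact hκ)
  refine ⟨fun x => x * S x, contDiff_id.mul hS, by simp, ?_, ?_, ?_⟩
  · filter_upwards [hS1] with x hx
    rw [hGh, hx, mul_zero]
  · rw [iteratedDeriv_one, (hasDerivAt_mul_cont hS.continuous.continuousAt).deriv, hS0]
  · filter_upwards [hS2] with z hz h1
    rw [hGh] at h1
    rcases mul_eq_zero.1 h1 with h2 | h2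
    · have : z.1 = 0 := by simpa using h2
      simp [this]
    · rw [hz h2]

theorem tube {Ψ : ℝ × (ℝ × (ℝ × ℝ)) → ℝ} (hΨ : Continuous Ψ) {κ : ℝ} (hκ : κ ≠ 0)
    (h0 : ∀ σ, Ψ (σ, (0, 0)) = κ) :
    ∃ η > 0, ∀ᶠ q in 𝓝 (0 : ℝ × ℝ), ∀ t : ℝ, |t| < η → ∀ σ ∈ Icc (0 : ℝ) 1,
      |κ| / 2 ≤ SignType.sign κ * Ψ (σ, (t, q)) := by
  apply ev_split (P := fun t q => ∀ σ ∈ Icc (0 : ℝ) 1, |κ| / 2 ≤ SignType.sign κ * Ψ (σ, (t, q)))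
  refine isCompact_Icc.eventually_forall_of_forall_eventually
    (P := fun (z : ℝ × (ℝ × ℝ)) (σ : ℝ) => |κ| / 2 ≤ SignType.sign κ * Ψ (σ, (z.1, z.2))) ?_
  intro σ hσ
  have hc : Continuous fun z : (ℝ × (ℝ × ℝ)) × ℝ => (SignType.sign κ : ℝ) * Ψ (z.2, (z.1.1, z.1.2)) := by
    fun_prop
  have h1 : |κ| / 2 < (SignType.sign κ : ℝ) * Ψ (σ, ((0 : ℝ), ((0 : ℝ × ℝ)))) := by
    rw [h0, sign_mul_self]
    exact half_lt_self (abs_pos.2 hκ)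
  have := (hc.tendsto ((0, 0), σ)).eventually (lt_mem_nhds h1)
  exact this.mono fun z hz => hz.le

theorem TE_sign {φ : ℝ × ℝ → ℝ → ℝ} {lam : ℝ × ℝ → ℝ} {k : ℕ} {κ : ℝ} (hκ : κ ≠ 0)
    (h : TE (fun q t => SignType.sign κ * φ q t) lam k) : TE φ lam k := by
  rcases lt_or_gt_of_ne hκ with h1 | h1
  · simp only [sign_neg h1] at h
    exact TE_neg (by simpa using h)
  · simpa [sign_pos h1] using h

theorem TE_factor {N n k : ℕ} {G : ℝ × ℝ → ℝ} {f g : ℝ → ℝ} {lam : ℝ × ℝ → ℝ} (hN : 1 ≤ N)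
    (hG : ContDiff ℝ (n + 2 : ℕ) G) (hf : ContDiff ℝ N f) (hg : ContDiff ℝ N g) (hf0 : f 0 = 0)
    (hg0 : g 0 = 0) (hGg : ∀ᶠ x in 𝓝 0, G (x, g x) = 0)
    (hcase : dy G 0 ≠ 0 ∨ (iteratedDeriv 1 g 0 = iteratedDeriv 1 f 0 ∧
      dx (dy G) 0 + dy (dy G) 0 * iteratedDeriv 1 f 0 ≠ 0))
    (hk : 1 ≤ k) (hTE : TE (fun q t => f t + q.2 - g (t + q.1)) lam k) :
    TE (fun q t => G (t + q.1, f t + q.2)) lam (k + 1) := by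
  have hGd := diff_of hG (by omega)
  have hdy : ContDiff ℝ (n + 1 : ℕ) (dy G) := contDiff_dy hG
  have hdyd := diff_of hdy (by omega)
  have hdyc := hdy.continuous
  have c1 : Continuous (dx (dy G)) := (contDiff_dx hdy).continuous
  have c2 : Continuous (dy (dy G)) := (contDiff_dy hdy).continuous
  have cf := hf.continuous
  have cg := hg.continuous
  have cf1 := hf.continuous_iteratedDeriv 1 (by norm_cast)
  have cg1 := hg.continuous_iteratedDeriv 1 (by norm_cast)
  have df : ∀ t, HasDerivAt f (iteratedDeriv 1 f t) t := fun t => by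
    simpa using hasDerivAt_iter (i := 0) hf (by omega) t
  have dg : ∀ t, HasDerivAt g (iteratedDeriv 1 g t) t := fun t => by
    simpa using hasDerivAt_iter (i := 0) hg (by omega) t
  let Φ : ℝ × (ℝ × (ℝ × ℝ)) → ℝ := fun w =>
    dy G (w.2.1 + w.2.2.1, g (w.2.1 + w.2.2.1) + w.1 * (f w.2.1 + w.2.2.2 - g (w.2.1 + w.2.2.1)))
  have hΦ : Continuous Φ := by
    apply hdyc.comp
    fun_prop
  have hΦi : ∀ q t a b, IntervalIntegrable (fun σ => Φ (σ, (t, q))) volume a b := fun q t a b =>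
    (hΦ.comp (by fun_prop : Continuous fun σ : ℝ => (σ, (t, q)))).intervalIntegrable a b
  refine TE.mul (ψ := fun q t => ∫ σ in (0:ℝ)..1, Φ (σ, (t, q))) hTE hk ?_ ?_
  · rcases hcase with hA | ⟨hB1, hB⟩
    · obtain ⟨η, hη, h⟩ := tube hΦ hA (fun σ => by simp [Φ, hf0, hg0]; rfl)
      apply TE_sign hA
      refine TE_bdd ⟨|dy G 0| / 2, by positivity, η, hη, h.mono fun q hq t ht => ?_⟩
      refine le_trans ?_ (le_abs_self _)
      rw [← intervalIntegral.integral_const_mul]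
      have := intervalIntegral.integral_mono_on (a := 0) (b := 1) zero_le_one
        (f := fun _ => |dy G 0| / 2) (μ := volume) (by simp) ((hΦi q t 0 1).const_mul (SignType.sign (dy G 0) : ℝ)) (hq t ht)
      simpa using this
    · set κ := dx (dy G) 0 + dy (dy G) 0 * iteratedDeriv 1 f 0 with hκ
      let Φ' : ℝ × (ℝ × (ℝ × ℝ)) → ℝ := fun w =>
        dx (dy G) (w.2.1 + w.2.2.1, g (w.2.1 + w.2.2.1) + w.1 * (f w.2.1 + w.2.2.2 - g (w.2.1 + w.2.2.1))) * 1
        + dy (dy G) (w.2.1 + w.2.2.1, g (w.2.1 + w.2.2.1) + w.1 * (f w.2.1 + w.2.2.2 - g (w.2.1 + w.2.2.1))) *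
          (iteratedDeriv 1 g (w.2.1 + w.2.2.1) + w.1 * (iteratedDeriv 1 f w.2.1 - iteratedDeriv 1 g (w.2.1 + w.2.2.1)))
      have hΦ' : Continuous Φ' := by
        simp only [Φ']
        fun_prop
      have hder : ∀ σ q t, HasDerivAt (fun t => Φ (σ, (t, q))) (Φ' (σ, (t, q))) t := by
        intro σ q t
        have hg' := (dg (t + q.1)).comp_add_const t q.1
        exact chain2 hdyd ((hasDerivAt_id t).add_const q.1)
          (hg'.fun_add ((((df t).add_const q.2).fun_sub hg').const_mul σ))
      obtain ⟨η, hη, h⟩ := tube hΦ' hB (fun σ => by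
        simp only [Φ', Prod.fst_zero, Prod.snd_zero, add_zero, hf0, hg0, hB1, sub_self, mul_zero, mul_one, ← Prod.zero_eq_mk, hκ])
      apply TE_sign hB
      refine TE_slope ⟨|κ| / 2, by positivity, η, hη, h.mono fun q hq x hx y hy hxy => ?_⟩
      rw [← intervalIntegral.integral_const_mul, ← intervalIntegral.integral_const_mul,
        ← intervalIntegral.integral_sub ((hΦi q y 0 1).const_mul _) ((hΦi q x 0 1).const_mul _)]
      have := intervalIntegral.integral_mono_on (a := 0) (b := 1) zero_le_one
        (f := fun _ => |κ| / 2 * (y - x)) (μ := volume) (by simp)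
        (((hΦi q y 0 1).const_mul (SignType.sign κ : ℝ)).sub ((hΦi q x 0 1).const_mul (SignType.sign κ : ℝ)))
        (fun σ hσ => slope_ge (ordConn_abs η) (fun t _ => (hder σ q t).const_mul (SignType.sign κ : ℝ))
          (fun t ht => hq t ht σ hσ) x hx y hy hxy)
      simpa using this
  · apply ev_split (P := fun t q => G (t + q.1, f t + q.2) = (f t + q.2 - g (t + q.1)) * ∫ σ in (0:ℝ)..1, Φ (σ, (t, q)))
    have ht : Tendsto (fun z : ℝ × (ℝ × ℝ) => z.1 + z.2.1) (𝓝 (0, 0)) (𝓝 0) := by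
      have : Continuous (fun z : ℝ × (ℝ × ℝ) => z.1 + z.2.1) := by fun_prop
      simpa using this.tendsto (0, 0)
    filter_upwards [ht.eventually hGg] with z hz
    obtain ⟨t, q⟩ := z
    set w := f t + q.2 - g (t + q.1) with hw
    have hd : ∀ σ : ℝ, HasDerivAt (fun σ => G (t + q.1, g (t + q.1) + σ * w)) (w * Φ (σ, (t, q))) σ := by
      intro σ
      have h1 : HasDerivAt (fun σ : ℝ => g (t + q.1) + σ * w) w σ := by
        simpa using ((hasDerivAt_id σ).mul_const w).const_add (g (t + q.1))
      have := chain2 hGd (hasDerivAt_const σ (t + q.1)) h1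
      simp only [mul_zero, zero_add] at this
      rw [mul_comm]
      exact this
    have := intervalIntegral.integral_eq_sub_of_hasDerivAt (a := 0) (b := 1) (fun σ _ => hd σ) ((hΦi q t 0 1).const_mul w)
    rw [intervalIntegral.integral_const_mul] at this
    show G (t + q.1, f t + q.2) = w * ∫ σ in (0:ℝ)..1, Φ (σ, (t, q))
    rw [this]
    have hz' : G (t + q.1, g (t + q.1)) = 0 := hz
    simp [hz', hw]

theorem TE_trans1 {N n : ℕ} {G : ℝ × ℝ → ℝ} {f : ℝ → ℝ} (hN : 1 ≤ N)
    (hG : ContDiff ℝ (n + 1 : ℕ) G) (hf : ContDiff ℝ N f) (hf0 : f 0 = 0)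
    (h : dx G 0 + dy G 0 * iteratedDeriv 1 f 0 ≠ 0) :
    TE (fun q t => G (t + q.1, f t + q.2)) (fun _ => 1) 1 := by
  have hGd := diff_of hG (by omega)
  have c1 : Continuous (dx G) := (contDiff_dx hG).continuous
  have c2 : Continuous (dy G) := (contDiff_dy hG).continuous
  have cf := hf.continuous
  have cf1 := hf.continuous_iteratedDeriv 1 (by norm_cast)
  have df : ∀ t, HasDerivAt f (iteratedDeriv 1 f t) t := fun t => by
    simpa using hasDerivAt_iter (i := 0) hf (by omega) t
  refine TE_deriv (k := 0) (D := fun i q t => if i = 0 then G (t + q.1, f t + q.2) else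
    dx G (t + q.1, f t + q.2) * 1 + dy G (t + q.1, f t + q.2) * iteratedDeriv 1 f t) ?_ ?_ ?_
  · intro i hi q t
    obtain rfl : i = 0 := by omega
    simpa using chain2 hGd ((hasDerivAt_id t).add_const q.1) ((df t).add_const q.2)
  · simp only [zero_add, one_ne_zero, if_false]
    fun_prop
  · simp only [Prod.fst_zero, Prod.snd_zero, add_zero, zero_add, one_ne_zero, if_false, hf0, mul_one, ← Prod.zero_eq_mk]
    exact h

theorem TE_trans2 {N n : ℕ} {G : ℝ × ℝ → ℝ} {f : ℝ → ℝ} (hN : 2 ≤ N)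
    (hG : ContDiff ℝ (n + 2 : ℕ) G) (hf : ContDiff ℝ N f) (hf0 : f 0 = 0) (hy : dy G 0 = 0)
    (h : dx (dx G) 0 + 2 * dx (dy G) 0 * iteratedDeriv 1 f 0 +
      dy (dy G) 0 * (iteratedDeriv 1 f 0) ^ 2 ≠ 0) :
    TE (fun q t => G (t + q.1, f t + q.2)) (fun _ => 1) 2 := by
  have hGd := diff_of hG (by omega)
  have hdx : ContDiff ℝ (n + 1 : ℕ) (dx G) := contDiff_dx hG
  have hdy : ContDiff ℝ (n + 1 : ℕ) (dy G) := contDiff_dy hG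
  have c2 : Continuous (dy G) := hdy.continuous
  have c3 : Continuous (dx (dx G)) := (contDiff_dx hdx).continuous
  have c4 : Continuous (dy (dx G)) := (contDiff_dy hdx).continuous
  have c5 : Continuous (dx (dy G)) := (contDiff_dx hdy).continuous
  have c6 : Continuous (dy (dy G)) := (contDiff_dy hdy).continuous
  have cf := hf.continuous
  have cf1 := hf.continuous_iteratedDeriv 1 (by norm_cast; omega)
  have cf2 := hf.continuous_iteratedDeriv 2 (by norm_cast)
  have df : ∀ t, HasDerivAt f (iteratedDeriv 1 f t) t := fun t => by
    simpa using hasDerivAt_iter (i := 0) hf (by omega) t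
  have df2 : ∀ t, HasDerivAt (iteratedDeriv 1 f) (iteratedDeriv 2 f t) t := fun t =>
    hasDerivAt_iter (i := 1) hf (by omega) t
  refine TE_deriv (k := 1) (D := fun i q t => if i = 0 then G (t + q.1, f t + q.2) else if i = 1 then
    dx G (t + q.1, f t + q.2) * 1 + dy G (t + q.1, f t + q.2) * iteratedDeriv 1 f t else
    (dx (dx G) (t + q.1, f t + q.2) * 1 + dy (dx G) (t + q.1, f t + q.2) * iteratedDeriv 1 f t) * 1 +
    ((dx (dy G) (t + q.1, f t + q.2) * 1 + dy (dy G) (t + q.1, f t + q.2) * iteratedDeriv 1 f t) *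
      iteratedDeriv 1 f t + dy G (t + q.1, f t + q.2) * iteratedDeriv 2 f t)) ?_ ?_ ?_
  · intro i hi q t
    have e1 := (hasDerivAt_id t).add_const q.1
    have e2 := (df t).add_const q.2
    interval_cases i
    · simpa using chain2 hGd e1 e2
    · simpa using ((chain2 (diff_of hdx (by omega)) e1 e2).mul_const 1).fun_add
        ((chain2 (diff_of hdy (by omega)) e1 e2).fun_mul (df2 t))
  · simp only [show (1 + 1 : ℕ) ≠ 0 by omega, show (1 + 1 : ℕ) ≠ 1 by omega, if_false]
    fun_prop
  · simp only [show (1 + 1 : ℕ) ≠ 0 by omega, show (1 + 1 : ℕ) ≠ 1 by omega, if_false]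
    simp only [Prod.fst_zero, Prod.snd_zero, add_zero, hf0, ← Prod.zero_eq_mk, hy, dxdy_symm hG]
    convert h using 1
    ring

theorem branch0 {N n₀ : ℕ} {G : ℝ × ℝ → ℝ} {f : ℝ → ℝ} {lam : ℝ × ℝ → ℝ} (hn : 3 ≤ n₀) (hN : n₀ ≤ N)
    (hG : ContDiff ℝ (N + 2 : ℕ) G) (hf : ContDiff ℝ N f) (hf0 : f 0 = 0)
    (hnd : G 0 = 0 → dx G 0 = 0 → dy G 0 = 0 →
      dx (dx G) 0 * dy (dy G) 0 - dx (dy G) 0 * dx (dy G) 0 ≠ 0)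
    (hAlt : (lam = (fun _ => 1) ∧ ∀ g, ContDiff ℝ N g → g 0 = 0 → (∀ᶠ x in 𝓝 0, G (x, g x) = 0) →
        ∃ m ≤ n₀ - 1, iteratedDeriv m f 0 ≠ iteratedDeriv m g 0) ∨
      (lam = (fun q => ‖q‖) ∧ (∀ᶠ x in 𝓝 0, G (x, f x) = 0) ∧
        ∃ m, 2 ≤ m ∧ m ≤ n₀ - 1 ∧ iteratedDeriv m f 0 ≠ 0)) :
    TE (fun q t => G (t + q.1, f t + q.2)) lam n₀ := by
  have hlam : ∀ᶠ q in 𝓝 (0 : ℝ × ℝ), lam q ≤ 1 := by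
    rcases hAlt with h | h
    · rw [h.1]; simp
    · rw [h.1]
      filter_upwards [Metric.ball_mem_nhds (0 : ℝ × ℝ) one_pos] with q hq
      have : ‖q‖ < 1 := by simpa using hq
      exact this.le
  have getg : (∃ g, ContDiff ℝ N g ∧ g 0 = 0 ∧ (∀ᶠ x in 𝓝 0, G (x, g x) = 0) ∧
      (dy G 0 ≠ 0 ∨ iteratedDeriv 1 g 0 = iteratedDeriv 1 f 0)) →
      ∃ g, ContDiff ℝ N g ∧ g 0 = 0 ∧ (∀ᶠ x in 𝓝 0, G (x, g x) = 0) ∧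
      (dy G 0 ≠ 0 ∨ iteratedDeriv 1 g 0 = iteratedDeriv 1 f 0) ∧
      ∃ k, 1 ≤ k ∧ k + 1 ≤ n₀ ∧ TE (fun q t => f t + q.2 - g (t + q.1)) lam k := by
    rintro ⟨g, hg, hg0, hGg, hg1⟩
    rcases hAlt with ⟨hl, h⟩ | ⟨hl, h, m, hm2, hm, hne⟩
    · obtain ⟨m, hm, hne⟩ := h g hg hg0 hGg
      have hm0 : m ≠ 0 := by
        rintro rfl
        simp [hf0, hg0] at hne
      obtain ⟨k, rfl⟩ := Nat.exists_eq_succ_of_ne_zero hm0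
      refine ⟨g, hg, hg0, hGg, hg1, k + 1, by omega, by omega, ?_⟩
      rw [hl]
      exact TE_F1_NN hf hg (by omega) hne
    · obtain ⟨k, rfl⟩ := Nat.exists_eq_add_of_le' hm2
      refine ⟨f, hf, hf0, h, Or.inr rfl, k + 1, by omega, by omega, ?_⟩
      rw [hl]
      exact TE_F1_Nest hf (by omega) hne
  by_cases h0 : G 0 = 0
  swap
  · refine TE.mono_lam (TE.mono_exp (TE_bdd ?_) le_rfl (by omega : 1 ≤ n₀)) hlam
    have cG := hG.continuous
    have cf := hf.continuous
    exact ev_nonzero (Φ := fun z => G (z.1 + z.2.1, f z.1 + z.2.2)) (by fun_prop)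
      (by simp only [Prod.fst_zero, Prod.snd_zero, add_zero, hf0, ← Prod.zero_eq_mk]; exact h0)
  by_cases hy : dy G 0 = 0
  swap
  · obtain ⟨g, hg, hg0, hGg, _⟩ := implicit (by omega) hG (x₀ := 0) (y₀ := 0) h0 hy
    obtain ⟨g, hg, hg0, hGg, -, k, hk1, hk2, hk⟩ :=
      getg ⟨g, hg.of_le (by norm_cast; omega), hg0, hGg, Or.inl hy⟩
    exact (TE_factor (by omega) hG hf hg hf0 hg0 hGg (Or.inl hy) hk1 hk).mono_exp (by omega) hk2
  by_cases hx : dx G 0 = 0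
  swap
  · refine TE.mono_lam (TE.mono_exp (TE_trans1 (N := N) (n := N + 1) (by omega) hG hf hf0 ?_) le_rfl
      (by omega : 1 ≤ n₀)) hlam
    rw [hy]; simpa using hx
  by_cases hQ : dx (dx G) 0 + 2 * dx (dy G) 0 * iteratedDeriv 1 f 0 +
      dy (dy G) 0 * (iteratedDeriv 1 f 0) ^ 2 = 0
  swap
  · exact TE.mono_lam (TE.mono_exp (TE_trans2 (by omega) hG hf hf0 hy hQ) (by omega)
      (by omega : 2 ≤ n₀)) hlam
  have hdet := hnd h0 hx hy
  obtain ⟨h, hh, hGh, hA⟩ := blowup (by omega) hG h0 hx hy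
  obtain ⟨g, hg, hg0, hGg, hg1, -⟩ := branch_of_blowup (by omega) hh hGh hA hdet hQ
  obtain ⟨g, hg, hg0, hGg, hg1, k, hk1, hk2, hk⟩ := getg ⟨g, hg, hg0, hGg, Or.inr hg1⟩
  have hg1' : iteratedDeriv 1 g 0 = iteratedDeriv 1 f 0 := by
    rcases hg1 with h | h
    · exact absurd hy h
    · exact h
  refine (TE_factor (by omega) hG hf hg hf0 hg0 hGg (Or.inr ⟨hg1', ?_⟩) hk1 hk).mono_exp (by omega) hk2
  intro hκ
  apply hdet
  set s := iteratedDeriv 1 f 0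
  have h1 : dx (dx G) 0 + dx (dy G) 0 * s = 0 := by linear_combination hQ - s * hκ
  linear_combination dy (dy G) 0 * h1 - dx (dy G) 0 * hκ

end FS

end

section
open Set Filter Topology

namespace FS

/-- Local uniform estimate near `pt` for the part of the curve in `A`. -/
def GoodAt (e G : ℝ × ℝ → ℝ) (n₀ : ℕ) (pt : ℝ × ℝ) (A : Set (ℝ × ℝ)) : Prop :=
  ∃ C : ℝ, 0 < C ∧ ∀ᶠ p in 𝓝 pt, p ≠ 0 → ∀ ε : ℝ, 0 < ε → ε < 1 →
    μH[1] {k : ℝ × ℝ | k ∈ A ∧ e k = 0 ∧ |G (k + p)| ≤ ε} ≤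
      ENNReal.ofReal (C * (ε / ‖p‖) ^ (1 / (n₀ : ℝ)))

theorem GoodAt.mono {e G : ℝ × ℝ → ℝ} {n₀ : ℕ} {pt : ℝ × ℝ} {A B : Set (ℝ × ℝ)}
    (h : GoodAt e G n₀ pt A) (hBA : ∀ k ∈ B, e k = 0 → k ∈ A) : GoodAt e G n₀ pt B := by
  obtain ⟨C, hC, h⟩ := h
  refine ⟨C, hC, h.mono fun p hp hp0 ε h0 h1 => le_trans (measure_mono ?_) (hp hp0 ε h0 h1)⟩
  rintro k ⟨hk, hk1, hk2⟩
  exact ⟨hBA k hk hk1, hk1, hk2⟩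

theorem GoodAt.union {e G : ℝ × ℝ → ℝ} {n₀ : ℕ} {pt : ℝ × ℝ} {A B : Set (ℝ × ℝ)}
    (h : GoodAt e G n₀ pt A) (h' : GoodAt e G n₀ pt B) : GoodAt e G n₀ pt (A ∪ B) := by
  obtain ⟨C, hC, h⟩ := h
  obtain ⟨C', hC', h'⟩ := h'
  refine ⟨C + C', by positivity, ?_⟩
  filter_upwards [h, h'] with p hp hp' hp0 ε h0 h1
  have hs : {k : ℝ × ℝ | k ∈ A ∪ B ∧ e k = 0 ∧ |G (k + p)| ≤ ε} ⊆
      {k : ℝ × ℝ | k ∈ A ∧ e k = 0 ∧ |G (k + p)| ≤ ε} ∪ {k : ℝ × ℝ | k ∈ B ∧ e k = 0 ∧ |G (k + p)| ≤ ε} := by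
    rintro k ⟨hk | hk, hk1, hk2⟩
    · exact Or.inl ⟨hk, hk1, hk2⟩
    · exact Or.inr ⟨hk, hk1, hk2⟩
  refine (measure_mono hs).trans ((measure_union_le _ _).trans ?_)
  rw [add_mul, ENNReal.ofReal_add (by positivity) (by positivity)]
  exact add_le_add (hp hp0 ε h0 h1) (hp' hp0 ε h0 h1)

theorem GoodAt.null {e G : ℝ × ℝ → ℝ} {n₀ : ℕ} {pt : ℝ × ℝ} {A : Set (ℝ × ℝ)}
    (h : μH[1] A = 0) : GoodAt e G n₀ pt A := by
  refine ⟨1, one_pos, Eventually.of_forall fun p hp0 ε h0 h1 => ?_⟩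
  have : μH[1] {k : ℝ × ℝ | k ∈ A ∧ e k = 0 ∧ |G (k + p)| ≤ ε} = 0 :=
    measure_mono_null (fun k hk => hk.1) h
  rw [this]
  exact zero_le

theorem GoodAt.single {e G : ℝ × ℝ → ℝ} {n₀ : ℕ} {pt : ℝ × ℝ} (a : ℝ × ℝ) :
    GoodAt e G n₀ pt {a} := by
  apply GoodAt.null
  have := Measure.nullSingletonClass_hausdorff (ℝ × ℝ) (d := 1) one_pos
  exact measure_singleton a

/-- The consequence of nonflatness and no nesting used at one pair of points. -/
def HypX (e G : ℝ × ℝ → ℝ) (N n₀ : ℕ) (kt pt : ℝ × ℝ) : Prop :=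
  ∀ f : ℝ → ℝ, ContDiff ℝ N f → f 0 = 0 → (∀ᶠ t in 𝓝 (0 : ℝ), e (kt + (t, f t)) = 0) →
    (∀ g : ℝ → ℝ, ContDiff ℝ N g → g 0 = 0 → (∀ᶠ t in 𝓝 (0 : ℝ), G (kt + pt + (t, g t)) = 0) →
      ∃ m ≤ n₀ - 1, iteratedDeriv m f 0 ≠ iteratedDeriv m g 0) ∨
    (pt = 0 ∧ (∀ᶠ t in 𝓝 (0 : ℝ), G (kt + (t, f t)) = 0) ∧
      ∃ m, 2 ≤ m ∧ m ≤ n₀ - 1 ∧ iteratedDeriv m f 0 ≠ 0)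

/-- Nondegenerate Hessian at the singular points. -/
def ND (G : ℝ × ℝ → ℝ) : Prop := ∀ z, G z = 0 → dx G z = 0 → dy G z = 0 →
  dx (dx G) z * dy (dy G) z - dx (dy G) z * dx (dy G) z ≠ 0

theorem dx_trans (G : ℝ × ℝ → ℝ) (c : ℝ × ℝ) : dx (fun z => G (c + z)) = fun z => dx G (c + z) := by
  funext z
  simp only [dx, fderiv_comp_add_left]

theorem dy_trans (G : ℝ × ℝ → ℝ) (c : ℝ × ℝ) : dy (fun z => G (c + z)) = fun z => dy G (c + z) := by
  funext z
  simp only [dy, fderiv_comp_add_left]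

theorem ND.trans {G : ℝ × ℝ → ℝ} (h : ND G) (c : ℝ × ℝ) : ND (fun z => G (c + z)) := by
  intro z
  simp only [dx_trans, dy_trans]
  exact h (c + z)

theorem contDiff_trans {n : ℕ} {G : ℝ × ℝ → ℝ} (h : ContDiff ℝ n G) (c : ℝ × ℝ) :
    ContDiff ℝ n (fun z => G (c + z)) := h.comp (contDiff_const.add contDiff_id)

theorem good_branch {e G : ℝ × ℝ → ℝ} {N n₀ : ℕ} {kt pt : ℝ × ℝ} (hn : 3 ≤ n₀) (hN : n₀ ≤ N)
    (hG : ContDiff ℝ (N + 2 : ℕ) G) (hnd : ND G) (hyp : HypX e G N n₀ kt pt)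
    {f : ℝ → ℝ} (hf : ContDiff ℝ N f) (hf0 : f 0 = 0)
    (hef : ∀ᶠ t in 𝓝 (0 : ℝ), e (kt + (t, f t)) = 0) :
    ∃ η > 0, GoodAt e G n₀ pt {k | ∃ t : ℝ, |t| < η ∧ k = kt + (t, f t)} := by
  have key : ∃ lam : ℝ × ℝ → ℝ, TE (fun q t => G (kt + pt + (t + q.1, f t + q.2))) lam n₀ ∧
      ∃ L > 0, ∀ᶠ q in 𝓝 (0 : ℝ × ℝ), pt + q ≠ 0 → 0 < lam q ∧ ‖pt + q‖ ≤ L * lam q := by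
    have hG' := contDiff_trans hG (kt + pt)
    have hnd' := hnd.trans (kt + pt) 0
    rcases hyp f hf hf0 hef with h | ⟨rfl, h1, h2⟩
    · refine ⟨fun _ => 1, branch0 hn hN hG' hf hf0 hnd' (Or.inl ⟨rfl, h⟩), ‖pt‖ + 1, by positivity, ?_⟩
      filter_upwards [Metric.ball_mem_nhds (0 : ℝ × ℝ) one_pos] with q hq _
      have : ‖q‖ < 1 := by simpa using hq
      refine ⟨one_pos, ?_⟩
      have := norm_add_le pt q
      linarith
    · refine ⟨fun q => ‖q‖, branch0 hn hN hG' hf hf0 hnd' (Or.inr ⟨rfl, by simpa using h1, h2⟩), 1, one_pos, ?_⟩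
      filter_upwards with q hq
      rw [zero_add] at hq
      simp [hq]
  obtain ⟨lam, ⟨η₁, hη₁, C, hC, hTE⟩, L, hL, hlam⟩ := key
  have hγ : ContDiff ℝ N (fun t : ℝ => kt + (t, f t)) := by fun_prop
  obtain ⟨K, T, hT, hlip⟩ := (hγ.of_le (m := 1) (by norm_cast; omega)).contDiffAt (x := (0 : ℝ)) |>.exists_lipschitzOnWith
  obtain ⟨η₂, hη₂, hball⟩ := Metric.mem_nhds_iff.1 hT
  refine ⟨min η₁ η₂, lt_min hη₁ hη₂, (K + 1) * C * L ^ (1 / (n₀ : ℝ)), by positivity, ?_⟩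
  have ht : Tendsto (fun p : ℝ × ℝ => p - pt) (𝓝 pt) (𝓝 0) := by
    have : Continuous fun p : ℝ × ℝ => p - pt := by fun_prop
    simpa using this.tendsto pt
  filter_upwards [ht.eventually hTE, ht.eventually hlam] with p h1 h2 hp0 ε hε _
  obtain ⟨hl0, hl⟩ := h2 (by simpa using hp0)
  rw [add_sub_cancel] at hl
  have hp : 0 < ‖p‖ := norm_pos_iff.2 hp0
  set l := lam (p - pt) with hldef
  have h3 := h1 hl0 (ε / l) (by positivity)
  rw [div_mul_cancel₀ _ hl0.ne'] at h3
  set S := {t : ℝ | |t| < η₁ ∧ |G (kt + pt + (t + (p - pt).1, f t + (p - pt).2))| ≤ ε} with hS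
  have hsub : {k : ℝ × ℝ | k ∈ {k | ∃ t : ℝ, |t| < min η₁ η₂ ∧ k = kt + (t, f t)} ∧ e k = 0 ∧ |G (k + p)| ≤ ε} ⊆
      (fun t : ℝ => kt + (t, f t)) '' (S ∩ T) := by
    rintro k ⟨⟨t, ht, rfl⟩, -, hk⟩
    refine ⟨t, ⟨⟨lt_of_lt_of_le ht (min_le_left _ _), ?_⟩, hball ?_⟩, rfl⟩
    · convert hk using 3
      ext <;> simp <;> ring
    · simpa using lt_of_lt_of_le ht (min_le_right _ _)
  have h4 := (hlip.mono (inter_subset_right (s := S))).hausdorffMeasure_image_le (d := 1) zero_le_one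
  rw [hausdorffMeasure_real] at h4
  refine (measure_mono hsub).trans (h4.trans ?_)
  calc (K : ENNReal) ^ (1 : ℝ) * volume (S ∩ T) ≤ ENNReal.ofReal K * ENNReal.ofReal (C * (ε / l) ^ (1 / (n₀ : ℝ))) := by
        gcongr
        · simp
        · exact (measure_mono inter_subset_left).trans h3
    _ = ENNReal.ofReal (K * (C * (ε / l) ^ (1 / (n₀ : ℝ)))) := by
        exact (ENNReal.ofReal_mul K.coe_nonneg).symm
    _ ≤ _ := by
        apply ENNReal.ofReal_le_ofReal
        have h5 : (ε / l) ^ (1 / (n₀ : ℝ)) ≤ (L * (ε / ‖p‖)) ^ (1 / (n₀ : ℝ)) := by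
          apply Real.rpow_le_rpow (by positivity) _ (by positivity)
          rw [← mul_div_assoc, div_le_div_iff₀ hl0 hp]
          nlinarith
        rw [Real.mul_rpow hL.le (by positivity)] at h5
        have hK : (0:ℝ) ≤ K := K.2
        calc (K : ℝ) * (C * (ε / l) ^ (1 / (n₀ : ℝ))) ≤ (K + 1) * (C * (L ^ (1 / (n₀ : ℝ)) * (ε / ‖p‖) ^ (1 / (n₀ : ℝ)))) := by
              gcongr
              linarith
          _ = _ := by ring

end FS

end

section
open Set Filter Topology

namespace FS

theorem tendsto_sub_zero (kt : ℝ × ℝ) : Tendsto (fun k : ℝ × ℝ => k - kt) (𝓝 kt) (𝓝 0) := by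
  have : Continuous fun k : ℝ × ℝ => k - kt := by fun_prop
  simpa using this.tendsto kt

theorem local_graph {e G : ℝ × ℝ → ℝ} {N n₀ : ℕ} {kt pt : ℝ × ℝ} (hn : 3 ≤ n₀) (hN : n₀ ≤ N)
    (he : ContDiff ℝ (N + 2 : ℕ) e)
    (hG : ContDiff ℝ (N + 2 : ℕ) G) (hnd : ND G) (hyp : HypX e G N n₀ kt pt)
    (h0 : e kt = 0) (hy : dy e kt ≠ 0) : ∃ W ∈ 𝓝 kt, GoodAt e G n₀ pt W := by
  have he' := contDiff_trans he kt
  obtain ⟨f, hf, hf0, hf1, hf2⟩ := implicit (by omega) he' (x₀ := 0) (y₀ := 0)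
    (by rw [← Prod.zero_eq_mk, add_zero]; exact h0)
    (by
      show dy (fun z => e (kt + z)) 0 ≠ 0
      rw [dy_trans]; simpa using hy)
  obtain ⟨η, hη, hgood⟩ := good_branch hn hN hG hnd hyp (hf.of_le (by norm_cast; omega)) hf0 hf1
  have ht := tendsto_sub_zero kt
  have h1 : ∀ᶠ z : ℝ × ℝ in 𝓝 0, |z.1| < η := by
    have : Continuous fun z : ℝ × ℝ => |z.1| := by fun_prop
    have := this.tendsto 0
    exact this.eventually (gt_mem_nhds (by simpa using hη))
  refine ⟨_, (ht.eventually h1).and (ht.eventually hf2), hgood.mono ?_⟩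
  rintro k ⟨hk1, hk2⟩ hk
  refine ⟨(k - kt).1, hk1, ?_⟩
  rw [← hk2 (by simpa using hk)]
  ext <;> simp

theorem local_cone {e G : ℝ × ℝ → ℝ} {N n₀ : ℕ} {kt pt : ℝ × ℝ} (hn : 3 ≤ n₀) (hN : n₀ ≤ N)
    (he : ContDiff ℝ (N + 2 : ℕ) e) (hne : ND e)
    (hG : ContDiff ℝ (N + 2 : ℕ) G) (hnd : ND G) (hyp : HypX e G N n₀ kt pt)
    (h0 : e kt = 0) (hx : dx e kt = 0) (hy : dy e kt = 0) :
    ∃ W ∈ 𝓝 kt, GoodAt e G n₀ pt (W ∩ {k | |k.2 - kt.2| ≤ |k.1 - kt.1|}) := by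
  have he' := contDiff_trans he kt
  have hx' : dx (fun z => e (kt + z)) 0 = 0 := by rw [dx_trans]; simpa using hx
  have hy' : dy (fun z => e (kt + z)) 0 = 0 := by rw [dy_trans]; simpa using hy
  have h0' : e (kt + 0) = 0 := by simpa using h0
  have hdet := hne.trans kt 0 h0' hx' hy'
  obtain ⟨h, hh, hGh, hA⟩ := blowup (by omega) he' h0' hx' hy'
  set ψ : ℝ × ℝ → ℝ × ℝ := fun z => kt + (z.1, z.1 * z.2) with hψ
  have hloc : ∀ z₀ ∈ ({0} : Set ℝ) ×ˢ Icc (-1 : ℝ) 1, ∃ V ∈ 𝓝 z₀, GoodAt e G n₀ pt (ψ '' V) := by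
    rintro ⟨x, s₀⟩ ⟨hx0, -⟩
    obtain rfl : x = 0 := hx0
    by_cases hz : h (0, s₀) = 0
    · have hz' := hA s₀
      rw [hz] at hz'
      obtain ⟨f, hf, hf0, hf1, -, hf2⟩ := branch_of_blowup (G := fun z => e (kt + z)) (by omega) hh hGh hA hdet (s₀ := s₀) (by linarith)
      obtain ⟨η, hη, hgood⟩ := good_branch hn hN hG hnd hyp hf hf0 hf1
      have h1 : ∀ᶠ z : ℝ × ℝ in 𝓝 (0, s₀), |z.1| < η := by
        have : Continuous fun z : ℝ × ℝ => |z.1| := by fun_prop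
        have := this.tendsto (0, s₀)
        exact this.eventually (gt_mem_nhds (by simpa using hη))
      refine ⟨_, h1.and hf2, hgood.mono ?_⟩
      rintro k ⟨z, ⟨hk1, hk2⟩, rfl⟩ hk
      exact ⟨z.1, hk1, by rw [← hk2 hk]⟩
    · refine ⟨{z | h z ≠ 0}, hh.continuous.continuousAt.eventually_ne hz, (GoodAt.single kt).mono ?_⟩
      rintro k ⟨z, hzz, rfl⟩ hk
      have : z.1 ^ 2 * h z = 0 := (hGh z.1 z.2).symm.trans hk
      have : z.1 = 0 := by
        rcases mul_eq_zero.1 this with h | h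
        · simpa using h
        · exact absurd h hzz
      simp [hψ, this]
  have hcomp : IsCompact (({0} : Set ℝ) ×ˢ Icc (-1 : ℝ) 1) := isCompact_singleton.prod isCompact_Icc
  have hglob : ∃ V, IsOpen V ∧ ({0} : Set ℝ) ×ˢ Icc (-1 : ℝ) 1 ⊆ V ∧ GoodAt e G n₀ pt (ψ '' V) := by
    refine hcomp.induction_on (p := fun S => ∃ V, IsOpen V ∧ S ⊆ V ∧ GoodAt e G n₀ pt (ψ '' V)) ?_ ?_ ?_ ?_
    · exact ⟨∅, isOpen_empty, Subset.rfl, (GoodAt.single 0).mono (by simp)⟩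
    · rintro s t hst ⟨V, hV, hsV, hg⟩
      exact ⟨V, hV, hst.trans hsV, hg⟩
    · rintro s t ⟨V, hV, hsV, hg⟩ ⟨V', hV', hsV', hg'⟩
      refine ⟨V ∪ V', hV.union hV', union_subset_union hsV hsV', ?_⟩
      rw [image_union]
      exact hg.union hg'
    · intro z hz
      obtain ⟨V, hV, hg⟩ := hloc z hz
      obtain ⟨V', hVV, hV', hzV⟩ := mem_nhds_iff.1 hV
      refine ⟨V', mem_nhdsWithin_of_mem_nhds (hV'.mem_nhds hzV), V', hV', Subset.rfl, hg.mono ?_⟩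
      exact fun k hk _ => image_mono hVV hk
  obtain ⟨V, hV, hsub, hg⟩ := hglob
  obtain ⟨u, v, hu, hv, hu0, hvI, huv⟩ := generalized_tube_lemma isCompact_singleton isCompact_Icc hV hsub
  have hu0 : (0 : ℝ) ∈ u := hu0 rfl
  refine ⟨{k | k.1 - kt.1 ∈ u}, ?_, hg.mono ?_⟩
  · have : Continuous fun k : ℝ × ℝ => k.1 - kt.1 := by fun_prop
    exact this.continuousAt.preimage_mem_nhds (hu.mem_nhds (by simpa using hu0))
  · rintro k ⟨hk1, hk2⟩ -
    have hk2 : |k.2 - kt.2| ≤ |k.1 - kt.1| := hk2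
    by_cases hk0 : k.1 - kt.1 = 0
    · refine ⟨(0, 0), huv ⟨hu0, hvI (by simp)⟩, ?_⟩
      rw [hk0] at hk2
      have h3 : k.2 - kt.2 = 0 := by simpa using hk2
      ext
      · simp [hψ]; linarith
      · simp [hψ]; linarith
    · refine ⟨(k.1 - kt.1, (k.2 - kt.2) / (k.1 - kt.1)), huv ⟨hk1, hvI ?_⟩, ?_⟩
      · rw [mem_Icc, ← abs_le, abs_div, div_le_one (abs_pos.2 hk0)]
        exact hk2
      · ext
        · simp [hψ]
        · simp only [hψ, Prod.snd_add]
          field_simp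
          ring

theorem dx_swap (G : ℝ × ℝ → ℝ) : dx (fun z => G z.swap) = fun z => dy G z.swap := by
  funext z
  have := (ContinuousLinearEquiv.prodComm ℝ ℝ ℝ).comp_right_fderiv (f := G) (x := z)
  have h := congrArg (fun L : ℝ × ℝ →L[ℝ] ℝ => L (1, 0)) this
  exact h

theorem dy_swap (G : ℝ × ℝ → ℝ) : dy (fun z => G z.swap) = fun z => dx G z.swap := by
  funext z
  have := (ContinuousLinearEquiv.prodComm ℝ ℝ ℝ).comp_right_fderiv (f := G) (x := z)
  have h := congrArg (fun L : ℝ × ℝ →L[ℝ] ℝ => L (0, 1)) this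
  exact h

theorem ND.swap {n : ℕ} {G : ℝ × ℝ → ℝ} (hG : ContDiff ℝ (n + 2 : ℕ) G) (h : ND G) :
    ND (fun z => G z.swap) := by
  intro z h0 h1 h2
  simp only [dx_swap, dy_swap] at h1 h2 ⊢
  have := h z.swap h0 h2 h1
  rw [dxdy_symm hG]
  rwa [mul_comm (dy (dy G) z.swap)]

theorem contDiff_swap {n : ℕ} {G : ℝ × ℝ → ℝ} (h : ContDiff ℝ n G) :
    ContDiff ℝ n (fun z : ℝ × ℝ => G z.swap) := h.comp (contDiff_snd.prodMk contDiff_fst)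

theorem isometry_swap : Isometry (Prod.swap : ℝ × ℝ → ℝ × ℝ) :=
  Isometry.of_dist_eq fun x y => by simp [Prod.dist_eq, max_comm]

theorem norm_swap (p : ℝ × ℝ) : ‖p.swap‖ = ‖p‖ := by simp [Prod.norm_def, max_comm]

theorem GoodAt.of_swap {e G : ℝ × ℝ → ℝ} {n₀ : ℕ} {pt : ℝ × ℝ} {A : Set (ℝ × ℝ)}
    (h : GoodAt (fun z => e z.swap) (fun z => G z.swap) n₀ pt.swap A) :
    GoodAt e G n₀ pt (Prod.swap ⁻¹' A) := by
  obtain ⟨C, hC, h⟩ := h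
  have ht : Tendsto (Prod.swap : ℝ × ℝ → ℝ × ℝ) (𝓝 pt) (𝓝 pt.swap) := continuous_swap.tendsto pt
  refine ⟨C, hC, (ht.eventually h).mono fun p hp hp0 ε h0 h1 => ?_⟩
  have h2 := hp (fun h => hp0 (Prod.swap_injective h)) ε h0 h1
  rw [norm_swap] at h2
  rw [← isometry_swap.hausdorffMeasure_image (d := 1) (Or.inl zero_le_one)]
  refine (measure_mono ?_).trans h2
  rintro _ ⟨k, ⟨hk, hk1, hk2⟩, rfl⟩
  refine ⟨hk, by simpa using hk1, by simpa using hk2⟩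

theorem local_all {e G : ℝ × ℝ → ℝ} {N n₀ : ℕ} {kt pt : ℝ × ℝ} (hn : 3 ≤ n₀) (hN : n₀ ≤ N)
    (he : ContDiff ℝ (N + 2 : ℕ) e) (hne : ND e)
    (hG : ContDiff ℝ (N + 2 : ℕ) G) (hnd : ND G) (hyp : HypX e G N n₀ kt pt)
    (hyp' : HypX (fun z => e z.swap) (fun z => G z.swap) N n₀ kt.swap pt.swap)
    (h0 : e kt = 0) : ∃ W ∈ 𝓝 kt, GoodAt e G n₀ pt W := by
  have ht : Tendsto (Prod.swap : ℝ × ℝ → ℝ × ℝ) (𝓝 kt) (𝓝 kt.swap) := continuous_swap.tendsto kt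
  by_cases hy : dy e kt = 0
  swap
  · exact local_graph hn hN he hG hnd hyp h0 hy
  by_cases hx : dx e kt = 0
  swap
  · obtain ⟨W, hW, hg⟩ := local_graph hn hN (contDiff_swap he) (contDiff_swap hG) (hnd.swap hG) hyp'
      (by simpa using h0) (by rw [dy_swap]; simpa using hx)
    exact ⟨_, ht hW, hg.of_swap⟩
  obtain ⟨W, hW, hg⟩ := local_cone hn hN he hne hG hnd hyp h0 hx hy
  obtain ⟨W', hW', hg'⟩ := local_cone hn hN (contDiff_swap he) (hne.swap he) (contDiff_swap hG) (hnd.swap hG) hyp'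
      (by simpa using h0) (by rw [dx_swap]; simpa using hy) (by rw [dy_swap]; simpa using hx)
  refine ⟨W ∩ Prod.swap ⁻¹' W', inter_mem hW (ht hW'), (hg.union hg'.of_swap).mono ?_⟩
  rintro k ⟨hk, hk'⟩ -
  rcases le_total (|k.2 - kt.2|) (|k.1 - kt.1|) with h | h
  · exact Or.inl ⟨hk, h⟩
  · exact Or.inr ⟨hk', h⟩

/-- Global estimate by compactness. -/
theorem global_est {e G : ℝ × ℝ → ℝ} {n₀ : ℕ} 
    (hF : IsCompact {k : ℝ × ℝ | e k = 0}) (hGc : IsCompact {k : ℝ × ℝ | |G k| ≤ 1})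
    (h : ∀ kt pt, e kt = 0 → ∃ W ∈ 𝓝 kt, GoodAt e G n₀ pt W) :
    ∃ C : ℝ, 0 < C ∧ ∀ p : ℝ × ℝ, p ≠ 0 → ∀ ε : ℝ, 0 < ε → ε < 1 →
      μH[1] {k : ℝ × ℝ | e k = 0 ∧ |G (k + p)| ≤ ε} ≤
        ENNReal.ofReal (C * (ε / ‖p‖) ^ (1 / (n₀ : ℝ))) := by
  have h1 : ∀ pt, GoodAt e G n₀ pt {k | e k = 0} := by
    intro pt
    refine hF.induction_on (p := fun S => GoodAt e G n₀ pt S) ?_ ?_ ?_ ?_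
    · exact (GoodAt.single 0).mono (by simp)
    · exact fun s t hst ht => ht.mono fun k hk _ => hst hk
    · exact fun s t hs ht => hs.union ht
    · intro k hk
      obtain ⟨W, hW, hg⟩ := h k pt hk
      exact ⟨W, mem_nhdsWithin_of_mem_nhds hW, hg⟩
  have hK : IsCompact ((fun z : (ℝ × ℝ) × (ℝ × ℝ) => z.1 - z.2) '' ({k : ℝ × ℝ | |G k| ≤ 1} ×ˢ {k : ℝ × ℝ | e k = 0})) :=
    (hGc.prod hF).image (by fun_prop)
  set K := ((fun z : (ℝ × ℝ) × (ℝ × ℝ) => z.1 - z.2) '' ({k : ℝ × ℝ | |G k| ≤ 1} ×ˢ {k : ℝ × ℝ | e k = 0})) with hKdef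
  have h2 : ∃ C : ℝ, 0 < C ∧ ∀ p ∈ K, p ≠ 0 → ∀ ε : ℝ, 0 < ε → ε < 1 →
      μH[1] {k : ℝ × ℝ | e k = 0 ∧ |G (k + p)| ≤ ε} ≤
        ENNReal.ofReal (C * (ε / ‖p‖) ^ (1 / (n₀ : ℝ))) := by
    refine hK.induction_on (p := fun S => ∃ C : ℝ, 0 < C ∧ ∀ p ∈ S, p ≠ 0 → ∀ ε : ℝ, 0 < ε → ε < 1 →
      μH[1] {k : ℝ × ℝ | e k = 0 ∧ |G (k + p)| ≤ ε} ≤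
        ENNReal.ofReal (C * (ε / ‖p‖) ^ (1 / (n₀ : ℝ)))) ?_ ?_ ?_ ?_
    · exact ⟨1, one_pos, by simp⟩
    · rintro s t hst ⟨C, hC, ht⟩
      exact ⟨C, hC, fun p hp => ht p (hst hp)⟩
    · rintro s t ⟨C, hC, hs⟩ ⟨C', hC', ht⟩
      refine ⟨C + C', by positivity, ?_⟩
      rintro p (hp | hp) hp0 ε e0 e1
      · refine (hs p hp hp0 ε e0 e1).trans (ENNReal.ofReal_le_ofReal ?_)
        gcongr
        linarith
      · refine (ht p hp hp0 ε e0 e1).trans (ENNReal.ofReal_le_ofReal ?_)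
        gcongr
        linarith
    · intro p _
      obtain ⟨C, hC, hp⟩ := h1 p
      refine ⟨_, mem_nhdsWithin_of_mem_nhds hp, C, hC, fun q hq hq0 ε e0 e1 => ?_⟩
      refine le_trans (measure_mono ?_) (hq hq0 ε e0 e1)
      exact fun k hk => ⟨hk.1, hk⟩
  obtain ⟨C, hC, h2⟩ := h2
  refine ⟨C, hC, fun p hp0 ε e0 e1 => ?_⟩
  by_cases hp : p ∈ K
  · exact h2 p hp hp0 ε e0 e1
  · have : {k : ℝ × ℝ | e k = 0 ∧ |G (k + p)| ≤ ε} = ∅ := by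
      rw [eq_empty_iff_forall_notMem]
      rintro k ⟨hk, hk'⟩
      exact hp ⟨(k + p, k), ⟨hk'.trans e1.le, hk⟩, by simp⟩
    rw [this]
    simp

end FS

end

section
open Set Filter Topology

namespace FS

theorem nest_use {P Q : ℝ → ℝ → ℝ} {n N : ℕ} (hnN : n ≤ N)
    (h : ∀ U ∈ nhds (0 : ℝ), ∀ f g : ℝ → ℝ,
      ContDiffOn ℝ N f U → ContDiffOn ℝ N g U → f 0 = 0 → g 0 = 0 →
      (∀ t ∈ U, P t (f t) = 0) → (∀ t ∈ U, Q t (g t) = 0) →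
      ∃ m : ℕ, m ≤ n ∧ iteratedDerivWithin m (fun t => f t - g t) U 0 ≠ 0)
    {f g : ℝ → ℝ} (hf : ContDiff ℝ N f) (hg : ContDiff ℝ N g) (hf0 : f 0 = 0) (hg0 : g 0 = 0)
    (hP : ∀ᶠ t in 𝓝 (0 : ℝ), P t (f t) = 0) (hQ : ∀ᶠ t in 𝓝 (0 : ℝ), Q t (g t) = 0) :
    ∃ m ≤ n, iteratedDeriv m f 0 ≠ iteratedDeriv m g 0 := by
  obtain ⟨U, hU, hUo, hU0⟩ := eventually_nhds_iff.1 (hP.and hQ)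
  obtain ⟨m, hm, hne⟩ := h U (hUo.mem_nhds hU0) f g hf.contDiffOn hg.contDiffOn hf0 hg0
    (fun t ht => (hU t ht).1) (fun t ht => (hU t ht).2)
  refine ⟨m, hm, fun heq => hne ?_⟩
  rw [iteratedDerivWithin_of_isOpen hUo hU0,
    iteratedDeriv_fun_sub (hf.contDiffAt.of_le (by norm_cast; omega)) (hg.contDiffAt.of_le (by norm_cast; omega)),
    heq, sub_self]

theorem flat_use {P : ℝ → ℝ → ℝ} {n N : ℕ}
    (h : ∀ U ∈ nhds (0 : ℝ), ∀ f : ℝ → ℝ,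
      ContDiffOn ℝ N f U → f 0 = 0 → (∀ t ∈ U, P t (f t) = 0) →
      ∃ m : ℕ, 2 ≤ m ∧ m ≤ n ∧ iteratedDerivWithin m f U 0 ≠ 0)
    {f : ℝ → ℝ} (hf : ContDiff ℝ N f) (hf0 : f 0 = 0)
    (hP : ∀ᶠ t in 𝓝 (0 : ℝ), P t (f t) = 0) :
    ∃ m, 2 ≤ m ∧ m ≤ n ∧ iteratedDeriv m f 0 ≠ 0 := by
  obtain ⟨U, hU, hUo, hU0⟩ := eventually_nhds_iff.1 hP
  obtain ⟨m, hm2, hm, hne⟩ := h U (hUo.mem_nhds hU0) f hf.contDiffOn hf0 hU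
  refine ⟨m, hm2, hm, ?_⟩
  rwa [iteratedDerivWithin_of_isOpen hUo hU0] at hne

theorem hypX_same {e : ℝ × ℝ → ℝ} {r n₀ : ℕ} (hr : n₀ - 1 ≤ r - 2)
    (hH5 : NonFlatCond e r n₀) (hH6 : NoNestingCond e r n₀) {kt : ℝ × ℝ} (pt : ℝ × ℝ) (h0 : e kt = 0) :
    HypX e e (r - 2) n₀ kt pt ∧
      HypX (fun z => e z.swap) (fun z => e z.swap) (r - 2) n₀ kt.swap pt.swap := by
  constructor
  · intro f hf hf0 hef
    by_cases hp : pt = 0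
    · exact Or.inr ⟨hp, hef, flat_use (P := fun t y => e (kt.1 + t, kt.2 + y)) (hH5 kt h0).1 hf hf0 hef⟩
    · refine Or.inl fun g hg hg0 hGg => ?_
      have h1 : e (kt + pt) = 0 := by
        have := hGg.self_of_nhds
        rwa [hg0, ← Prod.zero_eq_mk, add_zero] at this
      exact nest_use (P := fun t y => e (kt.1 + t, kt.2 + y)) (Q := fun t y => e ((kt + pt).1 + t, (kt + pt).2 + y)) hr
        (hH6.1 kt (kt + pt) h0 h1 (by simpa using hp)).1 hf hg hf0 hg0 hef hGg
  · intro f hf hf0 hef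
    by_cases hp : pt = 0
    · exact Or.inr ⟨by simp [hp], hef, flat_use (P := fun t y => e (kt.1 + y, kt.2 + t)) (hH5 kt h0).2 hf hf0 hef⟩
    · refine Or.inl fun g hg hg0 hGg => ?_
      have h1 : e (kt + pt) = 0 := by
        have := hGg.self_of_nhds
        rwa [hg0, ← Prod.zero_eq_mk, add_zero] at this
      exact nest_use (P := fun t y => e (kt.1 + y, kt.2 + t)) (Q := fun t y => e ((kt + pt).1 + y, (kt + pt).2 + t)) hr
        (hH6.1 kt (kt + pt) h0 h1 (by simpa using hp)).2 hf hg hf0 hg0 hef hGg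

theorem hypX_refl {e : ℝ × ℝ → ℝ} {r n₀ : ℕ} (hr : n₀ - 1 ≤ r - 2)
    (hH6 : NoNestingCond e r n₀) (hev : ¬ ∀ k : ℝ × ℝ, e (-k) = e k)
    {kt : ℝ × ℝ} (pt : ℝ × ℝ) (h0 : e kt = 0) :
    HypX e (fun k => e (-k)) (r - 2) n₀ kt pt ∧
      HypX (fun z => e z.swap) (fun z => (fun k => e (-k)) z.swap) (r - 2) n₀ kt.swap pt.swap := by
  constructor
  · intro f hf hf0 hef
    refine Or.inl fun g hg hg0 hGg => ?_
    have h1 : e (-(kt + pt)) = 0 := by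
      have := hGg.self_of_nhds
      rwa [hg0, ← Prod.zero_eq_mk, add_zero] at this
    exact nest_use (P := fun t y => e (kt.1 + t, kt.2 + y)) (Q := fun t y => e (-((kt + pt).1 + t, (kt + pt).2 + y))) hr
      (hH6.2 hev kt (kt + pt) h0 h1).1 hf hg hf0 hg0 hef hGg
  · intro f hf hf0 hef
    refine Or.inl fun g hg hg0 hGg => ?_
    have h1 : e (-(kt + pt)) = 0 := by
      have := hGg.self_of_nhds
      rwa [hg0, ← Prod.zero_eq_mk, add_zero] at this
    exact nest_use (P := fun t y => e (kt.1 + y, kt.2 + t)) (Q := fun t y => e (-((kt + pt).1 + y, (kt + pt).2 + t))) hr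
      (hH6.2 hev kt (kt + pt) h0 h1).2 hf hg hf0 hg0 hef hGg

theorem nd_of_hess {n : ℕ} {e : ℝ × ℝ → ℝ} (he : ContDiff ℝ (n + 2 : ℕ) e)
    (hH4 : ∀ k : ℝ × ℝ, e k = 0 → fderiv ℝ e k = 0 → HessCond e k) : ND e := by
  intro z h0 hx hy
  have hfd : fderiv ℝ e z = 0 := by
    ext
    · simpa [dx] using hx
    · simpa [dy] using hy
  obtain ⟨μ₁, μ₂, h1, h2, h⟩ := hH4 z h0 hfd
  rw [Matrix.charpoly_fin_two] at h
  have h3 := congrArg (fun q => Polynomial.eval 0 q) h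
  simp [Matrix.det_fin_two] at h3
  have e1 : hess2 e z (1, 0) (0, 1) = dx (dy e) z := dxdy_symm he z
  have e2 : hess2 e z (0, 1) (1, 0) = dx (dy e) z := rfl
  have e3 : hess2 e z (1, 0) (1, 0) = dx (dx e) z := rfl
  have e4 : hess2 e z (0, 1) (0, 1) = dy (dy e) z := rfl
  rw [e1, e2, e3, e4] at h3
  rw [h3]
  exact mul_ne_zero h1.ne' h2.ne

theorem dx_neg (G : ℝ × ℝ → ℝ) : dx (fun z => G (-z)) = fun z => -dx G (-z) := by
  funext z
  have := (ContinuousLinearEquiv.neg ℝ (M := ℝ × ℝ)).comp_right_fderiv (f := G) (x := z)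
  have h := congrArg (fun L : ℝ × ℝ →L[ℝ] ℝ => L (1, 0)) this
  refine Eq.trans h ?_
  show fderiv ℝ G (-z) (-(1, 0)) = -(fderiv ℝ G (-z) (1, 0))
  rw [map_neg]

theorem dy_neg (G : ℝ × ℝ → ℝ) : dy (fun z => G (-z)) = fun z => -dy G (-z) := by
  funext z
  have := (ContinuousLinearEquiv.neg ℝ (M := ℝ × ℝ)).comp_right_fderiv (f := G) (x := z)
  have h := congrArg (fun L : ℝ × ℝ →L[ℝ] ℝ => L (0, 1)) this
  refine Eq.trans h ?_
  show fderiv ℝ G (-z) (-(0, 1)) = -(fderiv ℝ G (-z) (0, 1))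
  rw [map_neg]

theorem dx_negf (G : ℝ × ℝ → ℝ) : dx (fun z => -G z) = fun z => -dx G z := by
  funext z
  simp [dx]

theorem dy_negf (G : ℝ × ℝ → ℝ) : dy (fun z => -G z) = fun z => -dy G z := by
  funext z
  simp [dy]

theorem ND.refl {G : ℝ × ℝ → ℝ} (h : ND G) : ND (fun z => G (-z)) := by
  intro z h0 h1 h2
  have e1 : dx (fun z => -dx G (-z)) = fun z => dx (dx G) (-z) := by
    rw [dx_negf (fun z => dx G (-z)), dx_neg]; simp
  have e2 : dy (fun z => -dy G (-z)) = fun z => dy (dy G) (-z) := by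
    rw [dy_negf (fun z => dy G (-z)), dy_neg]; simp
  have e3 : dx (fun z => -dy G (-z)) = fun z => dx (dy G) (-z) := by
    rw [dx_negf (fun z => dy G (-z)), dx_neg]; simp
  rw [dx_neg] at h1
  rw [dy_neg] at h2
  rw [dx_neg, dy_neg, e1, e2, e3]
  exact h (-z) h0 (by simpa using h1) (by simpa using h2)

theorem main_est {n₀ r : ℕ} (hn₀ : 3 ≤ n₀) (hr : 2 * n₀ + 1 ≤ r)
    {e : ℝ × ℝ → ℝ} (he : ContDiff ℝ r e)
    (hH1 : IsCompact {k : ℝ × ℝ | |e k| ≤ 1})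
    (hH4 : ∀ k : ℝ × ℝ, e k = 0 → fderiv ℝ e k = 0 → HessCond e k)
    (hH5 : NonFlatCond e r n₀) (hH6 : NoNestingCond e r n₀) :
    ∃ C : ℝ, 0 < C ∧ ∀ σ : ℝ, (σ = 1 ∨ σ = -1) → ∀ p : ℝ × ℝ, p ≠ 0 → ∀ ε : ℝ, 0 < ε → ε < 1 →
      μH[1] {k : ℝ × ℝ | e k = 0 ∧ |e (p + σ • k)| ≤ ε} ≤
        ENNReal.ofReal (C * (ε / ‖p‖) ^ (1 / (n₀ : ℝ))) := by
  have he' : ContDiff ℝ (r - 2 + 2 : ℕ) e := by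
    rwa [Nat.sub_add_cancel (by omega)]
  have hne : ND e := nd_of_hess he' hH4
  have hF : IsCompact {k : ℝ × ℝ | e k = 0} := by
    refine hH1.of_isClosed_subset (isClosed_eq he.continuous continuous_const) ?_
    intro k hk
    have hk : e k = 0 := hk
    show |e k| ≤ 1
    simp [hk]
  obtain ⟨C₁, hC₁, h₁⟩ := global_est (n₀ := n₀) hF hH1 fun kt pt h0 =>
    have := hypX_same (by omega) hH5 hH6 pt h0
    local_all hn₀ (by omega : n₀ ≤ r - 2) he' hne he' hne this.1 this.2 h0
  have hs : ∀ (p : ℝ × ℝ) (ε : ℝ), {k : ℝ × ℝ | e k = 0 ∧ |e (p + (1 : ℝ) • k)| ≤ ε} =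
      {k : ℝ × ℝ | e k = 0 ∧ |e (k + p)| ≤ ε} := by
    intro p ε
    ext k
    simp [add_comm]
  have hs' : ∀ (p : ℝ × ℝ) (ε : ℝ), {k : ℝ × ℝ | e k = 0 ∧ |e (p + (-1 : ℝ) • k)| ≤ ε} =
      {k : ℝ × ℝ | e k = 0 ∧ |e (-(k + -p))| ≤ ε} := by
    intro p ε
    ext k
    simp [add_comm]
  have h₂ : ∃ C₂ : ℝ, 0 < C₂ ∧ ∀ p : ℝ × ℝ, p ≠ 0 → ∀ ε : ℝ, 0 < ε → ε < 1 →
      μH[1] {k : ℝ × ℝ | e k = 0 ∧ |e (-(k + p))| ≤ ε} ≤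
        ENNReal.ofReal (C₂ * (ε / ‖p‖) ^ (1 / (n₀ : ℝ))) := by
    by_cases hev : ∀ k : ℝ × ℝ, e (-k) = e k
    · exact ⟨C₁, hC₁, by simpa only [hev] using h₁⟩
    · refine global_est (G := fun k => e (-k)) (n₀ := n₀) hF ?_ fun kt pt h0 =>
        have := hypX_refl (by omega) hH6 hev pt h0
        local_all hn₀ (by omega : n₀ ≤ r - 2) he' hne (he'.comp contDiff_neg) hne.refl this.1 this.2 h0
      have := hH1.neg
      exact this
  obtain ⟨C₂, hC₂, h₂⟩ := h₂
  refine ⟨C₁ + C₂, by positivity, ?_⟩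
  rintro σ (rfl | rfl) p hp ε e0 e1
  · rw [hs]
    refine (h₁ p hp ε e0 e1).trans (ENNReal.ofReal_le_ofReal ?_)
    gcongr
    linarith
  · rw [hs']
    refine (h₂ (-p) (by simpa using hp) ε e0 e1).trans (ENNReal.ofReal_le_ofReal ?_)
    rw [norm_neg]
    gcongr
    linarith

theorem final_bound {n : ℕ} (hn : n ≠ 0) {C ε δ x : ℝ} (hC : 0 < C) (hε : 0 < ε) (hδ : 0 < δ) (hx : 0 < x)
    (h : (ε / δ) ^ (1 / (n : ℝ)) ≤ C * (ε / x) ^ (1 / (n : ℝ))) : x ≤ C ^ n * δ := by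
  have hr : ∀ y : ℝ, 0 ≤ y → (y ^ (1 / (n : ℝ))) ^ n = y := by
    intro y hy
    rw [one_div]
    exact Real.rpow_inv_natCast_pow hy hn
  have h1 := pow_le_pow_left₀ (by positivity) h n
  rw [mul_pow, hr _ (by positivity), hr _ (by positivity), ← mul_div_assoc, div_le_div_iff₀ hδ hx] at h1
  have h2 : ε * x ≤ ε * (C ^ n * δ) := by linarith
  exact le_of_mul_le_mul_left h2 hε

end FS

end

/-- **Length of overlap, global version.** Under (H1)–(H6) there is `D > 0` such that for
every `0 < δ < 1` and each sign `σ`, the Lebesgue measure of the set of `p ∈ ℝ²` for which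
the arc length of `{k ∈ F : |e (p + σ k)| ≤ M^j}` is at least `(M^j/δ)^(1/n₀)` for some
integer `j < 0` is at most `D δ²`. -/
theorem stmt_4 (n₀ r : ℕ) (hn₀ : 3 ≤ n₀) (hr : 2 * n₀ + 1 ≤ r)
    (e : ℝ × ℝ → ℝ) (he : ContDiff ℝ r e)
    (hH1 : IsCompact {k : ℝ × ℝ | |e k| ≤ 1})
    (hH3 : {k : ℝ × ℝ | e k = 0 ∧ fderiv ℝ e k = 0}.Finite)
    (hH4 : ∀ k : ℝ × ℝ, e k = 0 → fderiv ℝ e k = 0 → HessCond e k)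
    (hH5 : NonFlatCond e r n₀) (hH6 : NoNestingCond e r n₀)
    (M : ℝ) (hM : 1 < M) :
    ∃ D : ℝ, 0 < D ∧ ∀ δ : ℝ, 0 < δ → δ < 1 → ∀ σ : ℝ, (σ = 1 ∨ σ = -1) →
      volume {p : ℝ × ℝ | ∃ j : ℤ, j < 0 ∧
          ENNReal.ofReal ((M ^ j / δ) ^ ((1 : ℝ) / n₀)) ≤
            μH[1] {k : ℝ × ℝ | e k = 0 ∧ |e (p + σ • k)| ≤ M ^ j}} ≤
        ENNReal.ofReal (D * δ ^ 2) := by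
  obtain ⟨C, hC, h⟩ := FS.main_est hn₀ hr he hH1 hH4 hH5 hH6
  refine ⟨4 * (C ^ n₀) ^ 2, by positivity, ?_⟩
  intro δ hδ _ σ hσ
  have hsub : {p : ℝ × ℝ | ∃ j : ℤ, j < 0 ∧
          ENNReal.ofReal ((M ^ j / δ) ^ ((1 : ℝ) / n₀)) ≤
            μH[1] {k : ℝ × ℝ | e k = 0 ∧ |e (p + σ • k)| ≤ M ^ j}} ⊆
      Metric.closedBall 0 (C ^ n₀ * δ) := by
    rintro p ⟨j, hj, hp⟩
    rw [mem_closedBall_zero_iff]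
    by_cases hp0 : p = 0
    · rw [hp0, norm_zero]
      positivity
    have hε : 0 < M ^ j := by positivity
    have hε1 : M ^ j < 1 := zpow_lt_one_of_neg₀ hM hj
    have h1 := hp.trans (h σ hσ p hp0 (M ^ j) hε hε1)
    have hpp : 0 < ‖p‖ := norm_pos_iff.2 hp0
    rw [ENNReal.ofReal_le_ofReal_iff (by positivity)] at h1
    exact FS.final_bound (by omega) hC hε hδ hpp h1
  refine (measure_mono hsub).trans ?_
  have h0 : (0 : ℝ × ℝ) = (0, 0) := rfl
  rw [h0, ← closedBall_prod_same, Measure.volume_eq_prod, Measure.prod_prod, Real.volume_closedBall,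
    ← ENNReal.ofReal_mul (by positivity)]
  apply ENNReal.ofReal_le_ofReal
  apply le_of_eq
  ring
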